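/- Let $k$ be an algebraically closed field, let $V\subseteq\mathbb P^n$ and $W\subseteq\mathbb P^m$ be smooth projective varieties over $k$, and let $p\in V$ be a closed point. Put $N=(n+1)(m+1)-1$ and regard products of closed subschemes of $\mathbb P^n$ and $\mathbb P^m$ as closed subschemes of $\mathbb P^N$ via the Segre embedding $\mathbb P^n\times\mathbb P^m\hookrightarrow\mathbb P^N$. For a closed subscheme $T\subseteq\mathbb P^N$ let $C(T)\subseteq\mathbb A^{N+1}$ denote its affine cone, defined by the (saturated) homogeneous ideal of $T$. Let $H\subset W$ be a closed subscheme such that $\{p\}\times H\subset\{p\}\times W$ is a hyperplane section of $\{p\}\times W$ in $\mathbb P^N$, i.e. the scheme-theoretic intersection of $\{p\}\times W$ with a hyperplane of $\mathbb P^N$ not containing it. Put $Y=C(V\times W)$ and $Z=C(V\times H)\subset Y$, and let $f\colon X\to Y$ be the blow up of $Y$ along $Z$. Assume that $V$ and $W$ are both positive dimensional, that $W\subseteq\mathbb P^m$ is a complete intersection (its homogeneous ideal is generated by $\operatorname{codim}(W,\mathbb P^m)$ homogeneous polynomials), and that for every linear subvariety $\mathbb P^r\subseteq\mathbb P^m$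 the embedding $V\times\mathbb P^r\subset\mathbb P^N$ is projectively normal (its homogeneous coordinate ring is a normal domain). Then $X$ is Gorenstein, that is, $X$ is locally Noetherian and all its local rings are Gorenstein. -/

import Mathlib

open CategoryTheory AlgebraicGeometry MvPolynomial
open scoped TensorProduct DirectSum LinearAlgebra.Projectivization

universe u

noncomputable section

attribute [local instance] MvPolynomial.gradedAlgebra

/-! ### Closed subschemes of projective space -/

/-- The saturation of an ideal `I` of `k[x_i : i ∈ σ]` with respect to the irrelevant ideal: all
`F` such that every variable has a power multiplying `F` into `I`.  For finite `σ`,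
two homogeneous ideals define the same closed subscheme of projective space iff they have the same saturation. -/
def irrelevantSaturation {k : Type u} [Field k] {σ : Type} (I : Ideal (MvPolynomial σ k)) :
    Ideal (MvPolynomial σ k) where
  carrier := {F | ∀ i, ∃ N : ℕ, X i ^ N * F ∈ I}
  zero_mem' := fun i => ⟨0, by simp⟩
  add_mem' := by
    intro F G hF hG i
    obtain ⟨a, ha⟩ := hF i
    obtain ⟨b, hb⟩ := hG i
    refine ⟨a + b, ?_⟩
    have h : (X i : MvPolynomial σ k) ^ (a + b) * (F + G)
        = X i ^ b * (X i ^ a * F) + X i ^ a * (X i ^ b * G) := by ring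
    rw [h]
    exact I.add_mem (I.mul_mem_left _ ha) (I.mul_mem_left _ hb)
  smul_mem' := by
    intro c F hF i
    obtain ⟨a, ha⟩ := hF i
    refine ⟨a, ?_⟩
    have h : (X i : MvPolynomial σ k) ^ a * (c • F) = c * (X i ^ a * F) := by
      rw [smul_eq_mul]; ring
    rw [h]
    exact I.mul_mem_left _ ha

/-- A closed subscheme of the projective space over `k` with homogeneous coordinates `x_i`, `i ∈ σ`
(so of `P^n` for `σ = Fin (n + 1)`), given by its homogeneous ideal: closed subschemes of projective
space correspond bijectively to saturated homogeneous ideals of the polynomial ring (`σ` finite). -/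
structure ProjSubscheme (k : Type u) [Field k] (σ : Type) where
  /-- the closed subscheme defined by a saturated homogeneous ideal -/
  ofIdeal ::
  /-- the homogeneous ideal `I(T)` -/
  ideal : Ideal (MvPolynomial σ k)
  homogeneous : ideal.IsHomogeneous (homogeneousSubmodule σ k)
  saturated : irrelevantSaturation ideal ≤ ideal

namespace ProjSubscheme

variable {k : Type u} [Field k] {σ τ : Type}

/-- `S ≤ T` means that `S` is a closed subscheme of `T`. -/
instance : LE (ProjSubscheme k σ) := ⟨fun S T => T.ideal ≤ S.ideal⟩

/-- The homogeneous coordinate ring `k[x_i : i ∈ σ] / I(T)`, which is also the coordinate ring of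
the affine cone `C(T)` in the affine space with coordinates `x_i`. -/
def coordRing (T : ProjSubscheme k σ) : Type u := MvPolynomial σ k ⧸ T.ideal

instance (T : ProjSubscheme k σ) : CommRing T.coordRing :=
  inferInstanceAs (CommRing (MvPolynomial σ k ⧸ T.ideal))

instance (T : ProjSubscheme k σ) : Algebra k T.coordRing :=
  inferInstanceAs (Algebra k (MvPolynomial σ k ⧸ T.ideal))

/-- The quotient map onto the homogeneous coordinate ring. -/
def mk (T : ProjSubscheme k σ) : MvPolynomial σ k →ₐ[k] T.coordRing :=
  Ideal.Quotient.mkₐ k T.ideal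

lemma mk_surjective (T : ProjSubscheme k σ) : Function.Surjective T.mk :=
  Ideal.Quotient.mkₐ_surjective k T.ideal

lemma mk_eq_zero_iff (T : ProjSubscheme k σ) {F : MvPolynomial σ k} :
    T.mk F = 0 ↔ F ∈ T.ideal :=
  Ideal.Quotient.eq_zero_iff_mem

/-- The degree `d` part of the homogeneous coordinate ring. -/
def grading (T : ProjSubscheme k σ) (d : ℕ) : Submodule k T.coordRing :=
  (homogeneousSubmodule σ k d).map T.mk.toLinearMap

lemma mk_mem_grading (T : ProjSubscheme k σ) {d : ℕ} {F : MvPolynomial σ k}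
    (hF : F ∈ homogeneousSubmodule σ k d) : T.mk F ∈ T.grading d :=
  ⟨F, hF, rfl⟩

instance (T : ProjSubscheme k σ) : SetLike.GradedMonoid T.grading where
  one_mem := ⟨1, SetLike.GradedOne.one_mem, map_one (T.mk)⟩
  mul_mem := by
    rintro i j _ _ ⟨F, hF, rfl⟩ ⟨G, hG, rfl⟩
    exact ⟨F * G, SetLike.GradedMul.mul_mem hF hG, map_mul (T.mk) F G⟩

/-- Decomposition into homogeneous components, first on polynomials. -/
def preDecompose (T : ProjSubscheme k σ) : MvPolynomial σ k →ₗ[k] ⨁ d, T.grading d :=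
  (DirectSum.lmap fun d =>
      (T.mk.toLinearMap.restrict
        (p := homogeneousSubmodule σ k d) (q := T.grading d)
        fun _ hF => T.mk_mem_grading hF)) ∘ₗ
    (DirectSum.decomposeLinearEquiv (homogeneousSubmodule σ k)).toLinearMap

lemma preDecompose_of_mem (T : ProjSubscheme k σ) {d : ℕ} {F : MvPolynomial σ k}
    (hF : F ∈ homogeneousSubmodule σ k d) :
    T.preDecompose F = DirectSum.of (fun d => T.grading d) d
      ⟨T.mk F, T.mk_mem_grading hF⟩ := by
  have h : DirectSum.decompose (homogeneousSubmodule σ k) F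
      = DirectSum.of (fun d => homogeneousSubmodule σ k d) d ⟨F, hF⟩ :=
    DirectSum.decompose_of_mem _ hF
  simp only [preDecompose, LinearMap.comp_apply, LinearEquiv.coe_coe,
    DirectSum.decomposeLinearEquiv_apply, h, DirectSum.lmap_of]
  rfl

lemma preDecompose_eq_zero (T : ProjSubscheme k σ) {F : MvPolynomial σ k} (hF : F ∈ T.ideal) :
    T.preDecompose F = 0 := by
  refine DFinsupp.ext fun d => Subtype.ext ?_
  exact T.mk_eq_zero_iff.mpr (T.homogeneous d hF)

/-- Decomposition into homogeneous components on the homogeneous coordinate ring. -/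
def decomposeMap (T : ProjSubscheme k σ) : T.coordRing →+ ⨁ d, T.grading d :=
  QuotientAddGroup.lift T.ideal.toAddSubgroup T.preDecompose.toAddMonoidHom
    fun _ hF => T.preDecompose_eq_zero hF

lemma decomposeMap_mk (T : ProjSubscheme k σ) (F : MvPolynomial σ k) :
    T.decomposeMap (T.mk F) = T.preDecompose F := rfl

instance (T : ProjSubscheme k σ) : GradedAlgebra T.grading where
  toDecomposition := DirectSum.Decomposition.ofAddHom T.grading T.decomposeMap
    (by
      refine AddMonoidHom.ext fun x => ?_
      obtain ⟨F, rfl⟩ := T.mk_surjective x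
      rw [AddMonoidHom.comp_apply, decomposeMap_mk, AddMonoidHom.id_apply]
      induction F using DirectSum.Decomposition.inductionOn (homogeneousSubmodule σ k) with
      | zero => simp
      | homogeneous F =>
        rw [T.preDecompose_of_mem F.2]
        exact DirectSum.coeAddMonoidHom_of _ _ _
      | add F G hF hG => rw [map_add, map_add, map_add, hF, hG])
    (by
      refine DirectSum.addHom_ext fun d x => ?_
      obtain ⟨_, F, hF, rfl⟩ := x
      rw [AddMonoidHom.comp_apply, DirectSum.coeAddMonoidHom_of, AddMonoidHom.id_apply]
      exact T.preDecompose_of_mem hF)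

/-- The scheme `T = Proj (k[x_i : i ∈ σ] / I(T))`. -/
def toScheme (T : ProjSubscheme k σ) : Scheme.{u} := Proj T.grading

/-- The structure morphism `T ⟶ Spec k`. -/
def structureMap (T : ProjSubscheme k σ) : T.toScheme ⟶ Spec (CommRingCat.of k) :=
  Proj.toSpecZero T.grading ≫ Spec.map (CommRingCat.ofHom (algebraMap k (T.grading 0)))

/-- The dimension of `T`. -/
def dim (T : ProjSubscheme k σ) : WithBot ℕ∞ := topologicalKrullDim T.toScheme

/-- `T` is a (projective) variety, that is, a nonempty integral closed subscheme. -/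
def IsVariety (T : ProjSubscheme k σ) : Prop := T.ideal.IsPrime

/-- `T` is smooth over `k`. -/
def IsSmooth (T : ProjSubscheme k σ) : Prop := Smooth T.structureMap

/-- `T` is a complete intersection: its homogeneous ideal is generated by `codim T` homogeneous
polynomials of positive degree.  The codimension of `T` is the height of its homogeneous ideal. -/
def IsCompleteIntersection (T : ProjSubscheme k σ) : Prop :=
  ∃ (r : ℕ) (F : Fin r → MvPolynomial σ k),
    (∀ i, ∃ d : ℕ, 0 < d ∧ (F i).IsHomogeneous d) ∧
      T.ideal = Ideal.span (Set.range F) ∧ T.ideal.height = r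

/-- A variety `T` is projectively normal if its homogeneous coordinate ring is a normal domain. -/
def IsProjectivelyNormal (T : ProjSubscheme k σ) : Prop :=
  IsDomain T.coordRing ∧ IsIntegrallyClosed T.coordRing

/-- `T` is a linear subvariety `P^r`: its homogeneous ideal is generated by linear forms.  (Not all
linear forms can occur, as the irrelevant ideal is not saturated.) -/
def IsLinear (T : ProjSubscheme k σ) : Prop :=
  ∃ s : Set (MvPolynomial σ k), (∀ L ∈ s, L.IsHomogeneous 1) ∧ T.ideal = Ideal.span s

/-- `S` is a hyperplane section of `T`: the scheme-theoretic intersection of `T` with a hyperplane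
not containing `T`. -/
def IsHyperplaneSection (S T : ProjSubscheme k σ) : Prop :=
  ∃ L : MvPolynomial σ k, L.IsHomogeneous 1 ∧ L ∉ T.ideal ∧
    S.ideal = irrelevantSaturation (T.ideal ⊔ Ideal.span {L})

/-! ### Closed points -/

/-- The ideal generated by all homogeneous polynomials vanishing at the point `p`. -/
def pointIdeal (p : ℙ k (σ → k)) : Ideal (MvPolynomial σ k) :=
  Ideal.span {F | (∃ d : ℕ, F.IsHomogeneous d) ∧ eval p.rep F = 0}

lemma pointIdeal_homogeneous (p : ℙ k (σ → k)) :
    (pointIdeal p).IsHomogeneous (homogeneousSubmodule σ k) :=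
  Ideal.homogeneous_span _ _ fun _ hF => hF.1

lemma eval_eq_zero_of_mem_pointIdeal (p : ℙ k (σ → k)) {F : MvPolynomial σ k}
    (hF : F ∈ pointIdeal p) : eval p.rep F = 0 := by
  have h : pointIdeal p ≤ RingHom.ker (eval p.rep) := Ideal.span_le.mpr fun G hG => hG.2
  exact h hF

/-- A `k`-rational point of projective space, as a closed subscheme. -/
def point (p : ℙ k (σ → k)) : ProjSubscheme k σ where
  ideal := pointIdeal p
  homogeneous := pointIdeal_homogeneous p
  saturated := by
    intro F hF
    obtain ⟨i, hi⟩ : ∃ i, p.rep i ≠ 0 := by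
      by_contra! h
      exact p.rep_nonzero (funext h)
    obtain ⟨N, hN⟩ := hF i
    rw [mem_iff_homogeneousComponent_mem (pointIdeal_homogeneous p)]
    intro d
    refine Ideal.subset_span ⟨⟨d, homogeneousComponent_isHomogeneous d F⟩, ?_⟩
    have h := eval_eq_zero_of_mem_pointIdeal p
      (homogeneousComponent_mem_of_mem (pointIdeal_homogeneous p) hN (N + d))
    have h2 : homogeneousComponent (N + d) (X i ^ N * F) = X i ^ N * homogeneousComponent d F := by
      have hX : (X i ^ N : MvPolynomial σ k) ∈ homogeneousSubmodule σ k N := by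
        simpa using (isHomogeneous_X k i).pow N
      have h3 := DirectSum.coe_decompose_mul_add_of_left_mem (homogeneousSubmodule σ k)
        (j := d) (b := F) hX
      rw [← decomposition.decompose'_apply, ← decomposition.decompose'_apply]
      exact h3
    rw [h2, map_mul, map_pow, eval_X] at h
    exact (mul_eq_zero.mp h).resolve_left (pow_ne_zero _ hi)

/-! ### The Segre embedding -/

/-- The map `k[z_{ij}] → k[x]/I(S) ⊗ k[y]/I(T)`, `z_{ij} ↦ x_i ⊗ y_j`. -/
def segreHom (S : ProjSubscheme k σ) (T : ProjSubscheme k τ) :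
    MvPolynomial (σ × τ) k →ₐ[k] S.coordRing ⊗[k] T.coordRing :=
  aeval fun ij => S.mk (X ij.1) ⊗ₜ[k] T.mk (X ij.2)

lemma segreHom_monomial (S : ProjSubscheme k σ) (T : ProjSubscheme k τ) (s : σ × τ →₀ ℕ) (c : k) :
    ∃ a ∈ S.grading s.degree, ∃ b, S.segreHom T (monomial s c) = a ⊗ₜ[k] b := by
  induction s using Finsupp.induction_linear generalizing c with
  | zero =>
    refine ⟨1, by simpa using SetLike.GradedOne.one_mem, c • 1, ?_⟩
    rw [← C_apply, ← algebraMap_eq, AlgHom.commutes, Algebra.algebraMap_eq_smul_one,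
      Algebra.TensorProduct.one_def, TensorProduct.tmul_smul]
  | add s t hs ht =>
    obtain ⟨a, ha, b, hab⟩ := hs 1
    obtain ⟨a', ha', b', hab'⟩ := ht c
    refine ⟨a * a', ?_, b * b', ?_⟩
    · rw [map_add]
      exact SetLike.GradedMul.mul_mem ha ha'
    · rw [← one_mul c, ← monomial_mul, map_mul, hab, hab', Algebra.TensorProduct.tmul_mul_tmul]
  | single ij N =>
    refine ⟨S.mk (X ij.1 ^ N), ?_,
      c • T.mk (X ij.2 ^ N), ?_⟩
    · apply S.mk_mem_grading
      simpa using (isHomogeneous_X k ij.1).pow N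
    · rw [segreHom, aeval_monomial, Finsupp.prod_single_index (by simp)]
      simp [Algebra.algebraMap_eq_smul_one, Algebra.TensorProduct.tmul_pow]

lemma segreHom_homogeneousComponent (S : ProjSubscheme k σ) (T : ProjSubscheme k τ) (d : ℕ)
    (F : MvPolynomial (σ × τ) k) :
    S.segreHom T (homogeneousComponent d F) =
      (GradedAlgebra.proj S.grading d).rTensor T.coordRing (S.segreHom T F) := by
  induction F using MvPolynomial.induction_on' with
  | add F G hF hG => rw [map_add, map_add, map_add, map_add, hF, hG]
  | monomial s c =>
    obtain ⟨a, ha, b, hab⟩ := S.segreHom_monomial T s c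
    have hs : monomial s c ∈ homogeneousSubmodule (σ × τ) k s.degree :=
      isHomogeneous_monomial c rfl
    rw [homogeneousComponent_of_mem hs, hab, LinearMap.rTensor_tmul, GradedAlgebra.proj_apply]
    split_ifs with h
    · rw [hab, h, DirectSum.decompose_of_mem_same _ ha]
    · rw [DirectSum.decompose_of_mem_ne _ ha (Ne.symm h), map_zero, TensorProduct.zero_tmul]

lemma eq_zero_of_forall_pow_mul (S : ProjSubscheme k σ) {B : Type u} [CommRing B] [Algebra k B]
    (g : S.coordRing ⊗[k] B)
    (hg : ∀ i, ∃ N : ℕ, (S.mk (X i ^ N) ⊗ₜ[k] (1 : B)) * g = 0) : g = 0 := by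
  let b := (Module.Basis.ofVectorSpace k B).baseChange S.coordRing
  refine b.ext_elem fun β => ?_
  rw [map_zero, Finsupp.zero_apply]
  obtain ⟨G, hG⟩ := S.mk_surjective (b.repr g β)
  rw [← hG]
  refine S.mk_eq_zero_iff.mpr (S.saturated fun i => ?_)
  obtain ⟨N, hN⟩ := hg i
  refine ⟨N, S.mk_eq_zero_iff.mp ?_⟩
  have h : S.mk (X i ^ N) • g = 0 := by
    rw [Algebra.smul_def]
    exact hN
  have h2 := congrArg (fun w => b.repr w β) h
  simpa [map_mul, hG] using h2

/-- The closed subscheme `S × T ⊆ P^N` embedded by the Segre embedding of `P^n × P^m`, with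
homogeneous coordinates `z_{ij}` on `P^N`. -/
def segre [Finite σ] (S : ProjSubscheme k σ) (T : ProjSubscheme k τ) :
    ProjSubscheme k (σ × τ) where
  ideal := RingHom.ker (S.segreHom T)
  homogeneous := by
    intro d F hF
    have h : (DirectSum.decompose (homogeneousSubmodule (σ × τ) k) F d : MvPolynomial (σ × τ) k)
        = homogeneousComponent d F := decomposition.decompose'_apply F d
    rw [h, RingHom.mem_ker, segreHom_homogeneousComponent, RingHom.mem_ker.mp hF, map_zero]
  saturated := by
    intro F hF
    rw [RingHom.mem_ker]
    have key : ∀ i j, ∃ N : ℕ, ∀ M, N ≤ M → (S.mk (X i ^ M) ⊗ₜ[k]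
        T.mk (X j ^ M)) * S.segreHom T F = 0 := by
      intro i j
      obtain ⟨N, hN⟩ := hF (i, j)
      refine ⟨N, fun M hM => ?_⟩
      obtain ⟨c, rfl⟩ := Nat.exists_eq_add_of_le hM
      have h : S.segreHom T (X (i, j) ^ (N + c) * F) = 0 := by
        rw [pow_add, mul_right_comm, map_mul, RingHom.mem_ker.mp hN, zero_mul]
      rw [map_mul, map_pow] at h
      simpa [segreHom, Algebra.TensorProduct.tmul_pow] using h
    have right : (Algebra.TensorProduct.comm k S.coordRing T.coordRing) (S.segreHom T F) = 0 := by
      refine T.eq_zero_of_forall_pow_mul _ fun j => ?_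
      choose N hN using fun i => key i j
      obtain ⟨M, hM⟩ := (Set.finite_range N).bddAbove
      refine ⟨M, ?_⟩
      have left : ((1 : S.coordRing) ⊗ₜ[k] T.mk (X j ^ M))
          * S.segreHom T F = 0 := by
        refine S.eq_zero_of_forall_pow_mul _ fun i => ⟨M, ?_⟩
        rw [← mul_assoc, Algebra.TensorProduct.tmul_mul_tmul, mul_one, one_mul]
        exact hN i M (hM ⟨i, rfl⟩)
      have h := congrArg (Algebra.TensorProduct.comm k S.coordRing T.coordRing) left
      simpa using h
    simpa using right

end ProjSubscheme

/-! ### Blowing up -/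

/-- The degree `d` part `I^d t^d` of the Rees algebra `⊕ I^d t^d`. -/
def reesGrading {R : Type u} [CommRing R] (I : Ideal R) (d : ℕ) : Submodule R (reesAlgebra I) where
  carrier := {f | ∀ i, i ≠ d → (f : Polynomial R).coeff i = 0}
  zero_mem' := by intro i _; simp
  add_mem' := by
    intro f g hf hg i hi
    simp [hf i hi, hg i hi]
  smul_mem' := by
    intro c f hf i hi
    simp [hf i hi]

instance {R : Type u} [CommRing R] (I : Ideal R) : SetLike.GradedMonoid (reesGrading I) where
  one_mem := by
    intro i hi
    simp [Polynomial.coeff_one, hi]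
  mul_mem := by
    intro a b f g hf hg i hi
    rw [Subalgebra.coe_mul, Polynomial.coeff_mul]
    refine Finset.sum_eq_zero fun x hx => ?_
    rw [Finset.HasAntidiagonal.mem_antidiagonal] at hx
    by_cases h : x.1 = a
    · rw [hg x.2 (by omega), mul_zero]
    · rw [hf x.1 h, zero_mul]

/-- The component of degree `d` of an element of the Rees algebra. -/
def reesComponent {R : Type u} [CommRing R] (I : Ideal R) (f : reesAlgebra I) (d : ℕ) :
    reesGrading I d :=
  ⟨⟨Polynomial.monomial d ((f : Polynomial R).coeff d), reesAlgebra.monomial_mem.mpr (f.2 d)⟩, by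
    intro i hi
    exact Polynomial.coeff_monomial_of_ne _ hi⟩

lemma reesComponent_of_mem {R : Type u} [CommRing R] (I : Ideal R) {d : ℕ} (f : reesGrading I d) :
    reesComponent I f d = f := by
  refine Subtype.ext (Subtype.ext (Polynomial.ext fun i => ?_))
  by_cases hi : i = d
  · subst hi
    simp [reesComponent]
  · rw [f.2 i hi]
    exact Polynomial.coeff_monomial_of_ne _ hi

lemma reesComponent_of_mem_ne {R : Type u} [CommRing R] (I : Ideal R) {d e : ℕ}
    (f : reesGrading I d) (h : e ≠ d) : reesComponent I f e = 0 := by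
  refine Subtype.ext (Subtype.ext ?_)
  simp [reesComponent, f.2 e h]

lemma reesDecompose_aux {R : Type u} [CommRing R] (I : Ideal R) (f : reesAlgebra I) (d : ℕ) :
    DFinsupp.mk (β := fun d => reesGrading I d) (f : Polynomial R).support
      (fun d => reesComponent I f d) d = reesComponent I f d := by
  rw [DFinsupp.mk_apply]
  split_ifs with h
  · rfl
  · refine Subtype.ext (Subtype.ext ?_)
    simp [reesComponent, Polynomial.notMem_support_iff.mp h]

/-- The decomposition of the Rees algebra into its homogeneous parts. -/
def reesDecompose {R : Type u} [CommRing R] (I : Ideal R) :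
    reesAlgebra I →+ ⨁ d, reesGrading I d where
  toFun f := DFinsupp.mk (f : Polynomial R).support fun d => reesComponent I f d
  map_zero' := by
    refine DFinsupp.ext fun d => ?_
    simp
  map_add' f g := by
    refine DFinsupp.ext fun d => ?_
    rw [DFinsupp.add_apply]
    simp only [reesDecompose_aux]
    refine Subtype.ext (Subtype.ext ?_)
    simp [reesComponent]

instance {R : Type u} [CommRing R] (I : Ideal R) : GradedAlgebra (reesGrading I) where
  toDecomposition := DirectSum.Decomposition.ofAddHom (reesGrading I) (reesDecompose I)
    (by
      refine AddMonoidHom.ext fun f => Subtype.ext ?_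
      have h : reesDecompose I f = ∑ d ∈ (f : Polynomial R).support,
          DirectSum.of (fun d => reesGrading I d) d (reesComponent I f d) := by
        refine DFinsupp.ext fun e => ?_
        rw [DFinsupp.finsetSum_apply]
        refine (reesDecompose_aux I f e).trans ?_
        by_cases he : e ∈ (f : Polynomial R).support
        · rw [Finset.sum_eq_single_of_mem e he
            fun d _ hd => DirectSum.of_eq_of_ne _ _ _ hd.symm, DirectSum.of_eq_same]
        · rw [Finset.sum_eq_zero fun d hd => DirectSum.of_eq_of_ne d e _
            (fun hde => he (hde.symm ▸ hd))]
          refine Subtype.ext (Subtype.ext ?_)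
          simp [reesComponent, Polynomial.notMem_support_iff.mp he]
      rw [AddMonoidHom.comp_apply, h, map_sum, AddMonoidHom.id_apply]
      simp only [DirectSum.coeAddMonoidHom_of]
      rw [AddSubmonoidClass.coe_finsetSum]
      exact (Polynomial.as_sum_support _).symm)
    (by
      refine DirectSum.addHom_ext fun d f => ?_
      rw [AddMonoidHom.comp_apply, DirectSum.coeAddMonoidHom_of, AddMonoidHom.id_apply]
      refine DFinsupp.ext fun e => (reesDecompose_aux I _ e).trans ?_
      by_cases h : e = d
      · subst h
        rw [DirectSum.of_eq_same, reesComponent_of_mem]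
      · rw [DirectSum.of_eq_of_ne _ _ _ h, reesComponent_of_mem_ne I f h])

/-- The blow up `Proj (⊕_{d ≥ 0} I^d)` of `Spec R` along the closed subscheme `Spec (R / I)`. -/
def affineBlowUp {R : Type u} [CommRing R] (I : Ideal R) : Scheme.{u} := Proj (reesGrading I)

/-- For `Z ≤ Y` closed subschemes of a projective space, the ideal of the affine cone `C(Z)` in the
coordinate ring of the affine cone `C(Y)`. -/
def ProjSubscheme.coneIdeal {k : Type u} [Field k] {σ : Type} (Z Y : ProjSubscheme k σ) :
    Ideal Y.coordRing :=
  Z.ideal.map Y.mk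

/-! ### Gorenstein schemes -/

/-- A Gorenstein local ring: a Noetherian local ring of finite injective dimension over itself. -/
def IsGorensteinLocalRing (R : Type u) [CommRing R] : Prop :=
  IsLocalRing R ∧ IsNoetherianRing R ∧ ∃ d : ℕ, HasInjectiveDimensionLE (ModuleCat.of R R) d

/-- A Gorenstein scheme: locally Noetherian, and all its local rings are Gorenstein. -/
def IsGorensteinScheme (X : Scheme.{u}) : Prop :=
  IsLocallyNoetherian X ∧ ∀ x : X, IsGorensteinLocalRing (X.presheaf.stalk x)

end

noncomputable section

attribute [local instance] MvPolynomial.gradedAlgebra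

/-! ### Global dimension of polynomial rings -/

namespace HilbertSyzygy

/-- All `R`-modules have projective dimension at most `n`. -/
def GlobalDimLE (R : Type u) [CommRing R] (n : ℕ) : Prop :=
  ∀ M : ModuleCat.{u} R, HasProjectiveDimensionLE M n

lemma GlobalDimLE.of_ringEquiv {R S : Type u} [CommRing R] [CommRing S] (e : R ≃+* S) {n : ℕ}
    (h : GlobalDimLE R n) : GlobalDimLE S n := by
  intro N
  let : Module R N := Module.compHom N (e : R →+* S)
  have := h (ModuleCat.of R N)
  let := RingHomInvPair.of_ringEquiv e
  let := RingHomInvPair.of_ringEquiv e.symm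
  let l : (ModuleCat.of R N) ≃ₛₗ[RingHomClass.toRingHom e] N :=
    { toFun := fun x => x
      invFun := fun x => x
      map_add' := fun _ _ => rfl
      map_smul' := fun _ _ => rfl
      left_inv := fun _ => rfl
      right_inv := fun _ => rfl }
  exact ModuleCat.hasProjectiveDimensionLE_of_semiLinearEquiv e l n

lemma GlobalDimLE.field (k : Type u) [Field k] : GlobalDimLE k 0 := by
  intro M
  have : Projective M := by
    rw [← IsProjective.iff_projective]
    exact Module.Projective.of_free
  infer_instance

open Polynomial in
lemma hasProjectiveDimensionLE_baseChange {R S : Type u} [CommRing R] [CommRing S] [Algebra R S]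
    [Module.Flat R S] (n : ℕ) (M : ModuleCat.{u} R) (h : HasProjectiveDimensionLE M n) :
    HasProjectiveDimensionLE (ModuleCat.of S (S ⊗[R] M)) n := by
  induction n generalizing M with
  | zero =>
    simp only [HasProjectiveDimensionLE, zero_add] at h ⊢
    rw [← projective_iff_hasProjectiveDimensionLT_one, ← IsProjective.iff_projective] at h ⊢
    infer_instance
  | succ n ih =>
    obtain ⟨P, hP, f, hf⟩ : ∃ (P : ModuleCat.{u} R) (_ : Projective P) (f : P ⟶ M), Epi f := by
      obtain ⟨⟨P, f⟩⟩ := ModuleCat.enoughProjectives.{u}.1 M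
      exact ⟨P, inferInstance, f, inferInstance⟩
    have hsurj : Function.Surjective f.hom := (ModuleCat.epi_iff_surjective f).mp hf
    have hT := LinearMap.shortExact_shortComplexKer hsurj
    let g := (LinearMap.ker f.hom).subtype
    have hex : Function.Exact g f.hom := LinearMap.exact_subtype_ker_map f.hom
    let T' : ShortComplex (ModuleCat.{u} S) :=
      ModuleCat.shortComplexOfCompEqZero (g.baseChange S) (f.hom.baseChange S) (by
        rw [← LinearMap.baseChange_comp, hex.linearMap_comp_eq_zero, LinearMap.baseChange_zero])
    have hT' : T'.ShortExact := by
      refine ModuleCat.shortComplex_shortExact T' ?_ ?_ ?_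
      · exact lTensor_exact S hex hsurj
      · exact Module.Flat.lTensor_preserves_injective_linearMap g Subtype.val_injective
      · exact LinearMap.lTensor_surjective S hsurj
    have hP2 : Projective T'.X₂ := by
      rw [← IsProjective.iff_projective] at hP ⊢
      exact inferInstanceAs (Module.Projective S (S ⊗[R] P))
    have h1 := (hT.hasProjectiveDimensionLT_X₃_iff n hP).mp h
    exact (hT'.hasProjectiveDimensionLT_X₃_iff n hP2).mpr (ih _ h1)

section CharacteristicSequence

open Polynomial

variable (R : Type u) [CommRing R] (M : Type u) [AddCommGroup M] [Module R M] [Module R[X] M]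
  [IsScalarTower R R[X] M]

/-- Multiplication by `X` on an `R[X]`-module, as an `R`-linear map. -/
def mulX : M →ₗ[R] M := (LinearMap.lsmul R[X] M X).restrictScalars R

/-- The map `p ↦ X • p - X(p)` of `M[X]`. -/
def charMap : PolynomialModule R M →ₗ[R[X]] PolynomialModule R M where
  toFun p := (X : R[X]) • p - PolynomialModule.map R (mulX R M) p
  map_add' p q := by rw [smul_add, map_add]; abel
  map_smul' r p := by
    rw [PolynomialModule.map_smul, Algebra.algebraMap_self, Polynomial.map_id, RingHom.id_apply,
      smul_sub, smul_comm]

/-- Evaluation `∑ mᵢ Xⁱ ↦ ∑ Xⁱ • mᵢ`. -/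
def evalX : PolynomialModule R M →ₗ[R[X]] M where
  toFun p := p.coeff.sum fun i m => (X : R[X]) ^ i • m
  map_add' p q := Finsupp.sum_add_index' (fun _ => smul_zero _) fun _ _ _ => smul_add _ _ _
  map_smul' r p := by
    have hadd : ∀ p q : PolynomialModule R M, (p + q).coeff.sum (fun i m => (X : R[X]) ^ i • m)
        = p.coeff.sum (fun i m => (X : R[X]) ^ i • m)
          + q.coeff.sum (fun i m => (X : R[X]) ^ i • m) :=
      fun p q => Finsupp.sum_add_index' (fun _ => smul_zero _) fun _ _ _ => smul_add _ _ _
    rw [RingHom.id_apply]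
    induction p using PolynomialModule.induction_linear with
    | zero => simp
    | add p q hp hq => rw [smul_add, hadd, hadd, hp, hq, smul_add]
    | single i m =>
      induction r using Polynomial.induction_on' with
      | add p q hp hq => rw [add_smul, hadd, hp, hq, add_smul]
      | monomial j a =>
        rw [PolynomialModule.monomial_smul_single, PolynomialModule.coeff_single,
          PolynomialModule.coeff_single,
          Finsupp.sum_single_index (h := fun i m => (X : R[X]) ^ i • m) (smul_zero _),
          Finsupp.sum_single_index (h := fun i m => (X : R[X]) ^ i • m) (smul_zero _),
          ← smul_one_smul R[X] a m, smul_smul, smul_smul,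
          ← Polynomial.C_mul_X_pow_eq_monomial, pow_add, Polynomial.smul_eq_C_mul, mul_one]
        congr 1
        ring

lemma evalX_single (i : ℕ) (m : M) :
    evalX R M (PolynomialModule.single R i m) = (X : R[X]) ^ i • m :=
  Finsupp.sum_single_index (smul_zero _)

lemma charMap_single (i : ℕ) (m : M) :
    charMap R M (PolynomialModule.single R i m) =
      PolynomialModule.single R (i + 1) m - PolynomialModule.single R i ((X : R[X]) • m) := by
  change (X : R[X]) • _ - PolynomialModule.map R (mulX R M) _ = _
  rw [← monomial_one_one_eq_X, PolynomialModule.monomial_smul_single, PolynomialModule.map_single,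
    one_smul, add_comm 1 i, monomial_one_one_eq_X]
  rfl

lemma charMap_coeff_succ (p : PolynomialModule R M) (i : ℕ) :
    (charMap R M p).coeff (i + 1) = p.coeff i - (X : R[X]) • p.coeff (i + 1) := by
  induction p using PolynomialModule.induction_linear with
  | zero => simp
  | add p q hp hq =>
    rw [(charMap R M).map_add, PolynomialModule.coeff_add, Finsupp.add_apply, hp, hq,
      PolynomialModule.coeff_add, Finsupp.add_apply, Finsupp.add_apply, smul_add]
    abel
  | single j m =>
    rw [charMap_single, sub_eq_add_neg, PolynomialModule.coeff_add, Finsupp.add_apply,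
      ← neg_one_smul R[X], ← Polynomial.C_1, ← Polynomial.C_neg, ← Polynomial.monomial_zero_left,
      PolynomialModule.monomial_smul_apply]
    simp only [PolynomialModule.coeff_single, Finsupp.single_apply]
    by_cases h1 : j = i
    · subst h1
      simp
    · by_cases h2 : j = i + 1
      · subst h2
        simp
      · simp [h1, h2]

lemma charMap_injective : Function.Injective (charMap R M) := by
  rw [injective_iff_map_eq_zero]
  intro p hp
  by_contra hne
  have hc : p.coeff ≠ 0 := fun h => hne (PolynomialModule.coeff_eq_zero.mp h)
  obtain ⟨d, hd, hmax⟩ := p.coeff.support.exists_max_image id (Finsupp.support_nonempty_iff.mpr hc)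
  have h0 : p.coeff (d + 1) = 0 := by
    by_contra h
    have := hmax (d + 1) (Finsupp.mem_support_iff.mpr h)
    simp at this
  have h1 := charMap_coeff_succ R M p d
  rw [hp, h0, smul_zero, sub_zero] at h1
  exact (Finsupp.mem_support_iff.mp hd) h1.symm

lemma charMap_evalX_exact : Function.Exact (charMap R M) (evalX R M) := by
  have key : ∀ p : PolynomialModule R M,
      p - PolynomialModule.single R 0 (evalX R M p) ∈ LinearMap.range (charMap R M) := by
    intro p
    induction p using PolynomialModule.induction_linear with
    | zero => simp
    | add p q hp hq =>
      have := add_mem hp hq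
      rw [map_add, PolynomialModule.single_add]
      convert this using 1
      abel
    | single i m =>
      rw [evalX_single]
      induction i generalizing m with
      | zero => simp
      | succ i ih =>
        have h1 : charMap R M (PolynomialModule.single R i m) ∈ LinearMap.range (charMap R M) :=
          ⟨_, rfl⟩
        have := add_mem h1 (ih ((X : R[X]) • m))
        rw [charMap_single, smul_smul, ← pow_succ] at this
        convert this using 1
        abel
  intro p
  constructor
  · intro hp
    have := key p
    rw [hp, PolynomialModule.single_zero, sub_zero] at this
    exact this
  · rintro ⟨q, rfl⟩
    induction q using PolynomialModule.induction_linear with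
    | zero => simp
    | add p q hp hq => rw [map_add, map_add, hp, hq, add_zero]
    | single i m => rw [charMap_single, map_sub, evalX_single, evalX_single, smul_smul, ← pow_succ,
        sub_self]

lemma evalX_surjective : Function.Surjective (evalX R M) := fun m =>
  ⟨PolynomialModule.single R 0 m, by rw [evalX_single, pow_zero, one_smul]⟩

variable {R} in
lemma GlobalDimLE.polynomial {n : ℕ} (h : GlobalDimLE R n) : GlobalDimLE R[X] (n + 1) := by
  intro N
  let : Module R N := Module.compHom N (C : R →+* R[X])
  have : IsScalarTower R R[X] N := ⟨fun r p m => by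
    rw [Polynomial.smul_eq_C_mul, mul_smul]
    rfl⟩
  let T : ShortComplex (ModuleCat.{u} R[X]) :=
    ModuleCat.shortComplexOfCompEqZero (charMap R N) (evalX R N)
      (charMap_evalX_exact R N).linearMap_comp_eq_zero
  have hT : T.ShortExact := ModuleCat.shortComplex_shortExact T (charMap_evalX_exact R N)
    (charMap_injective R N) (evalX_surjective R N)
  have h1 : HasProjectiveDimensionLE (ModuleCat.of R[X] (PolynomialModule R N)) n := by
    have := hasProjectiveDimensionLE_baseChange (S := R[X]) n (ModuleCat.of R N) (h _)
    exact ModuleCat.hasProjectiveDimensionLE_of_linearEquiv (R := R[X])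
      (M := ModuleCat.of R[X] (R[X] ⊗[R] N)) (N := ModuleCat.of R[X] (PolynomialModule R N))
      (PolynomialModule.polynomialTensorProductLEquivPolynomialModule R N) n
  exact hT.hasProjectiveDimensionLT_X₃ (n + 1) h1 (hasProjectiveDimensionLT_of_ge _ (n + 1) _ (by lia))

end CharacteristicSequence

lemma GlobalDimLE.mvPolynomial {R : Type u} [CommRing R] {n : ℕ} (h : GlobalDimLE R n) (d : ℕ) :
    GlobalDimLE (MvPolynomial (Fin d) R) (n + d) := by
  induction d with
  | zero => exact h.of_ringEquiv (MvPolynomial.isEmptyRingEquiv R (Fin 0)).symm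
  | succ d ih => exact ih.polynomial.of_ringEquiv (MvPolynomial.finSuccEquiv R d).toRingEquiv.symm

lemma GlobalDimLE.hasInjectiveDimensionLE {R : Type u} [CommRing R] {n : ℕ}
    (h : GlobalDimLE R n) (M : ModuleCat.{u} R) : HasInjectiveDimensionLE M n := by
  refine HasInjectiveDimensionLT.mk (fun i hi Y e => ?_)
  have := h Y
  exact e.eq_zero_of_hasProjectiveDimensionLT (n + 1) hi

end HilbertSyzygy


/-! ### Injective dimension modulo a regular element -/

namespace InjectiveDimensionQuotient

variable {R : Type u} [CommRing R] (x : R)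

/-- The map induced on `x`-torsion, linear over `R / x`. -/
def torsionMap {M N : Type u} [AddCommGroup M] [Module R M] [AddCommGroup N] [Module R N]
    (g : M →ₗ[R] N) :
    Submodule.torsionBy R M x →ₗ[R ⧸ Ideal.span {x}] Submodule.torsionBy R N x where
  toFun m := ⟨g m, by
    rw [Submodule.mem_torsionBy_iff, ← map_smul, Submodule.smul_coe_torsionBy, map_zero]⟩
  map_add' a b := Subtype.ext (map_add g _ _)
  map_smul' r a := by
    obtain ⟨r, rfl⟩ := Ideal.Quotient.mk_surjective r
    rw [Submodule.torsionBy.mk_ideal_smul, RingHom.id_apply, Submodule.torsionBy.mk_ideal_smul]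
    exact Subtype.ext (map_smul g r _)

lemma torsionBy_injective {I : Type u} [AddCommGroup I] [Module R I] [Module.Injective R I] :
    Module.Injective (R ⧸ Ideal.span {x}) (Submodule.torsionBy R I x) := by
  refine ⟨fun X Y _ _ _ _ f hf g => ?_⟩
  let : Module R X := Module.compHom X (Ideal.Quotient.mk (Ideal.span {x}))
  let : Module R Y := Module.compHom Y (Ideal.Quotient.mk (Ideal.span {x}))
  have hzero : Ideal.Quotient.mk (Ideal.span {x}) x = 0 :=
    Ideal.Quotient.eq_zero_iff_mem.mpr (Ideal.mem_span_singleton_self x)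
  let f' : X →ₗ[R] Y :=
    { toFun := f, map_add' := map_add f, map_smul' := fun r a => map_smul f _ a }
  let g' : X →ₗ[R] I :=
    { toFun := fun a => g a
      map_add' := fun a b => by rw [map_add]; rfl
      map_smul' := fun r a => by
        change ((g (Ideal.Quotient.mk (Ideal.span {x}) r • a) : Submodule.torsionBy R I x) : I) = r • (g a : I)
        rw [map_smul, Submodule.torsionBy.mk_ideal_smul]
        rfl }
  obtain ⟨h, hh⟩ := Module.Injective.out f' hf g'
  refine ⟨{ toFun := fun b => ⟨h b, ?_⟩, map_add' := ?_, map_smul' := ?_ }, ?_⟩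
  · rw [Submodule.mem_torsionBy_iff, ← map_smul]
    change h (Ideal.Quotient.mk (Ideal.span {x}) x • b) = 0
    rw [hzero, zero_smul, map_zero]
  · exact fun a b => Subtype.ext (map_add h a b)
  · intro r a
    obtain ⟨r, rfl⟩ := Ideal.Quotient.mk_surjective r
    rw [RingHom.id_apply, Submodule.torsionBy.mk_ideal_smul]
    exact Subtype.ext (map_smul h r a)
  · exact fun a => Subtype.ext (hh a)

variable {x}

lemma smul_surjective_of_injective (hx : IsSMulRegular R x) (I : Type u) [AddCommGroup I]
    [Module R I] [Module.Injective R I] (i : I) : ∃ j : I, x • j = i := by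
  obtain ⟨h, hh⟩ := Module.Injective.out (LinearMap.lsmul R R x) hx (LinearMap.toSpanSingleton R I i)
  refine ⟨h 1, ?_⟩
  have := hh 1
  rw [LinearMap.toSpanSingleton_apply, one_smul] at this
  rw [← this, ← map_smul, LinearMap.lsmul_apply]

/-- Embedding into an injective module, with injective dimension of the cokernel. -/
lemma exists_injective_hull (M : Type u) [AddCommGroup M] [Module R M] :
    ∃ (I : Type u) (_ : AddCommGroup I) (_ : Module R I) (_ : Module.Injective R I)
      (f : M →ₗ[R] I), Function.Injective f := by
  obtain ⟨⟨I, _, f, _⟩⟩ := (inferInstance : EnoughInjectives (ModuleCat.{u} R)).1 (ModuleCat.of R M)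
  exact ⟨I, inferInstance, inferInstance,
    (Module.injective_iff_injective_object R I).mpr (by assumption), f.hom,
    (ModuleCat.mono_iff_injective f).mp inferInstance⟩

lemma hasInjectiveDimensionLE_torsionBy (hx : IsSMulRegular R x) (n : ℕ) (C : Type u)
    [AddCommGroup C] [Module R C] (hC : ∀ c : C, ∃ c', x • c' = c)
    (h : HasInjectiveDimensionLE (ModuleCat.of R C) n) :
    HasInjectiveDimensionLE
      (ModuleCat.of (R ⧸ Ideal.span {x}) (Submodule.torsionBy R C x)) n := by
  induction n generalizing C with
  | zero =>
    simp only [HasInjectiveDimensionLE, zero_add] at h ⊢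
    rw [← injective_iff_hasInjectiveDimensionLT_one, ← Module.injective_iff_injective_object]
      at h ⊢
    exact torsionBy_injective x
  | succ n ih =>
    obtain ⟨I, _, _, hI, f, hf⟩ := exists_injective_hull (R := R) C
    let T : ShortComplex (ModuleCat.{u} R) :=
      ModuleCat.shortComplexOfCompEqZero f (LinearMap.range f).mkQ
        f.exact_map_mkQ_range.linearMap_comp_eq_zero
    have hT : T.ShortExact := ModuleCat.shortComplex_shortExact T f.exact_map_mkQ_range hf
      (Submodule.mkQ_surjective _)
    have hI2 : Injective T.X₂ := (Module.injective_iff_injective_object R I).mp hI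
    have hex : Function.Exact (torsionMap x f) (torsionMap x (LinearMap.range f).mkQ) := by
      intro b
      constructor
      · intro hb
        obtain ⟨c, hc⟩ := (f.exact_map_mkQ_range b).mp (congrArg Subtype.val hb)
        refine ⟨⟨c, ?_⟩, Subtype.ext hc⟩
        rw [Submodule.mem_torsionBy_iff]
        apply hf
        rw [map_smul, hc, Submodule.smul_coe_torsionBy, map_zero]
      · rintro ⟨c, rfl⟩
        exact Subtype.ext ((f.exact_map_mkQ_range (f c)).mpr ⟨c, rfl⟩)
    have hsurj : Function.Surjective (torsionMap x (LinearMap.range f).mkQ) := by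
      rintro ⟨q, hq⟩
      obtain ⟨i, rfl⟩ := Submodule.mkQ_surjective _ q
      rw [Submodule.mem_torsionBy_iff, ← map_smul] at hq
      obtain ⟨c, hc⟩ := (f.exact_map_mkQ_range (x • i)).mp hq
      obtain ⟨c', rfl⟩ := hC c
      refine ⟨⟨i - f c', ?_⟩, Subtype.ext ?_⟩
      · rw [Submodule.mem_torsionBy_iff, smul_sub, ← map_smul, hc, sub_self]
      · change (LinearMap.range f).mkQ (i - f c') = _
        rw [map_sub, (f.exact_map_mkQ_range (f c')).mpr ⟨c', rfl⟩, sub_zero]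
    let T' : ShortComplex (ModuleCat.{u} (R ⧸ Ideal.span {x})) :=
      ModuleCat.shortComplexOfCompEqZero (torsionMap x f) (torsionMap x (LinearMap.range f).mkQ)
        hex.linearMap_comp_eq_zero
    have hT' : T'.ShortExact := ModuleCat.shortComplex_shortExact T' hex
      (fun a b hab => Subtype.ext (hf (congrArg Subtype.val hab))) hsurj
    have hI3 : Injective T'.X₂ :=
      (Module.injective_iff_injective_object _ _).mp (torsionBy_injective x)
    refine (hT'.hasInjectiveDimensionLT_X₃_iff n hI3).mp (ih _ ?_ ?_)
    · intro q
      obtain ⟨i, rfl⟩ := Submodule.mkQ_surjective _ q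
      obtain ⟨j, rfl⟩ := smul_surjective_of_injective hx I i
      exact ⟨(LinearMap.range f).mkQ j, (map_smul _ _ _).symm⟩
    · exact (hT.hasInjectiveDimensionLT_X₃_iff n hI2).mpr h

section Connecting

variable {I : Type u} [AddCommGroup I] [Module R I] {f : R →ₗ[R] I} (hf : Function.Injective f)

lemma exists_smul_eq (c : Submodule.torsionBy R (I ⧸ LinearMap.range f) x) :
    ∃ (i : I) (r : R), (LinearMap.range f).mkQ i = c ∧ f r = x • i := by
  obtain ⟨q, hq⟩ := c
  obtain ⟨i, rfl⟩ := Submodule.mkQ_surjective _ q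
  rw [Submodule.mem_torsionBy_iff, ← map_smul] at hq
  obtain ⟨r, hr⟩ := (f.exact_map_mkQ_range (x • i)).mp hq
  exact ⟨i, r, rfl, hr⟩

lemma mk_eq_mk_of_smul_eq (hf : Function.Injective f) {i j : I} {r s : R}
    (hij : (LinearMap.range f).mkQ i = (LinearMap.range f).mkQ j)
    (hr : f r = x • i) (hs : f s = x • j) :
    Ideal.Quotient.mk (Ideal.span {x}) r = Ideal.Quotient.mk (Ideal.span {x}) s := by
  rw [Ideal.Quotient.eq, Ideal.mem_span_singleton']
  obtain ⟨a, ha⟩ := (f.exact_map_mkQ_range (i - j)).mp (by rw [map_sub, hij, sub_self])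
  refine ⟨a, hf ?_⟩
  rw [map_sub, hr, hs, ← smul_sub, ← ha, mul_comm, ← smul_eq_mul, map_smul]

/-- The connecting homomorphism from the `x`-torsion of `I / R` to `R / x`. -/
def connecting : Submodule.torsionBy R (I ⧸ LinearMap.range f) x →ₗ[R ⧸ Ideal.span {x}]
    R ⧸ Ideal.span {x} where
  toFun c := Ideal.Quotient.mk _ (exists_smul_eq c).choose_spec.choose
  map_add' a b := by
    have ha := (exists_smul_eq a).choose_spec.choose_spec
    have hb := (exists_smul_eq b).choose_spec.choose_spec
    have hab := (exists_smul_eq (a + b)).choose_spec.choose_spec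
    rw [← map_add]
    refine mk_eq_mk_of_smul_eq hf ?_ hab.2 (j := (exists_smul_eq a).choose +
      (exists_smul_eq b).choose) ?_
    · rw [hab.1, map_add, ha.1, hb.1]
      rfl
    · rw [map_add, ha.2, hb.2, smul_add]
  map_smul' r a := by
    obtain ⟨r, rfl⟩ := Ideal.Quotient.mk_surjective r
    have ha := (exists_smul_eq a).choose_spec.choose_spec
    have hra := (exists_smul_eq (Ideal.Quotient.mk (Ideal.span {x}) r • a)).choose_spec.choose_spec
    rw [RingHom.id_apply, smul_eq_mul, ← map_mul]
    refine mk_eq_mk_of_smul_eq hf ?_ hra.2 (j := r • (exists_smul_eq a).choose) ?_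
    · rw [hra.1, map_smul, ha.1, Submodule.torsionBy.mk_ideal_smul]
      rfl
    · rw [← smul_eq_mul, map_smul, ha.2, smul_comm]

lemma connecting_eq (c : Submodule.torsionBy R (I ⧸ LinearMap.range f) x) {i : I} {r : R}
    (hi : (LinearMap.range f).mkQ i = c) (hr : f r = x • i) :
    connecting hf c = Ideal.Quotient.mk _ r := by
  have hc := (exists_smul_eq c).choose_spec.choose_spec
  exact mk_eq_mk_of_smul_eq hf (hc.1.trans hi.symm) hc.2 hr

end Connecting

lemma hasInjectiveDimensionLE_quotient (hx : IsSMulRegular R x) (n : ℕ)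
    (h : HasInjectiveDimensionLE (ModuleCat.of R R) n) :
    HasInjectiveDimensionLE
      (ModuleCat.of (R ⧸ Ideal.span {x}) (R ⧸ Ideal.span {x})) n := by
  obtain ⟨I, _, _, hI, f, hf⟩ := exists_injective_hull (R := R) R
  let T : ShortComplex (ModuleCat.{u} R) :=
    ModuleCat.shortComplexOfCompEqZero f (LinearMap.range f).mkQ
      f.exact_map_mkQ_range.linearMap_comp_eq_zero
  have hT : T.ShortExact := ModuleCat.shortComplex_shortExact T f.exact_map_mkQ_range hf
    (Submodule.mkQ_surjective _)
  have hI2 : Injective T.X₂ := (Module.injective_iff_injective_object R I).mp hI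
  have hC : HasInjectiveDimensionLE (ModuleCat.of R (I ⧸ LinearMap.range f)) n :=
    (hT.hasInjectiveDimensionLT_X₃_iff n hI2).mpr
      (hasInjectiveDimensionLT_of_ge (ModuleCat.of R R) (n + 1) (n + 2) (by lia))
  have hC' := hasInjectiveDimensionLE_torsionBy hx n (I ⧸ LinearMap.range f) (fun q => by
    obtain ⟨i, rfl⟩ := Submodule.mkQ_surjective _ q
    obtain ⟨j, rfl⟩ := smul_surjective_of_injective hx I i
    exact ⟨(LinearMap.range f).mkQ j, (map_smul _ _ _).symm⟩) hC
  have hex : Function.Exact (torsionMap x (LinearMap.range f).mkQ) (connecting (x := x) hf) := by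
    intro c
    constructor
    · intro hc
      obtain ⟨i, r, hi, hr⟩ := exists_smul_eq c
      rw [connecting_eq hf c hi hr, Ideal.Quotient.eq_zero_iff_mem,
        Ideal.mem_span_singleton'] at hc
      obtain ⟨a, rfl⟩ := hc
      refine ⟨⟨i - f a, ?_⟩, Subtype.ext ?_⟩
      · rw [Submodule.mem_torsionBy_iff, smul_sub, ← map_smul, ← hr, smul_eq_mul, mul_comm,
          sub_self]
      · change (LinearMap.range f).mkQ (i - f a) = _
        rw [map_sub, (f.exact_map_mkQ_range (f a)).mpr ⟨a, rfl⟩, sub_zero, hi]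
    · rintro ⟨i, rfl⟩
      rw [connecting_eq hf _ (i := i) (r := 0) rfl, map_zero]
      rw [map_zero, Submodule.smul_coe_torsionBy]
  let T' : ShortComplex (ModuleCat.{u} (R ⧸ Ideal.span {x})) :=
    ModuleCat.shortComplexOfCompEqZero (torsionMap x (LinearMap.range f).mkQ) (connecting hf)
      hex.linearMap_comp_eq_zero
  have hT' : T'.ShortExact := by
    refine ModuleCat.shortComplex_shortExact T' hex ?_ ?_
    · change Function.Injective (torsionMap x (LinearMap.range f).mkQ)
      rw [injective_iff_map_eq_zero]
      intro i hi
      obtain ⟨r, hr⟩ := (f.exact_map_mkQ_range i).mp (congrArg Subtype.val hi)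
      have h0 : f (x • r) = f 0 := by rw [map_smul, hr, Submodule.smul_coe_torsionBy, map_zero]
      have h1 : r = 0 := hx ((hf h0).trans (smul_zero x).symm)
      exact Subtype.ext (by rw [← hr, h1, map_zero]; rfl)
    · intro q
      obtain ⟨r, rfl⟩ := Ideal.Quotient.mk_surjective q
      obtain ⟨i, hi⟩ := smul_surjective_of_injective hx I (f r)
      refine ⟨⟨(LinearMap.range f).mkQ i, ?_⟩, connecting_eq hf _ rfl hi.symm⟩
      rw [Submodule.mem_torsionBy_iff, ← map_smul, hi]
      exact (f.exact_map_mkQ_range _).mpr ⟨r, rfl⟩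
  have hI3 : Injective T'.X₁ :=
    (Module.injective_iff_injective_object _ _).mp (torsionBy_injective x)
  exact hT'.hasInjectiveDimensionLT_X₃ (n + 1) hC'
    (hasInjectiveDimensionLT_of_ge T'.X₁ 1 _ (by lia))

end InjectiveDimensionQuotient

/-- A ring has finite injective dimension as a module over itself. -/
def HasFiniteSelfInjectiveDimension (R : Type u) [CommRing R] : Prop :=
  ∃ d : ℕ, HasInjectiveDimensionLE (ModuleCat.of R R) d

namespace HasFiniteSelfInjectiveDimension

variable {R : Type u} [CommRing R]

lemma of_ringEquiv {S : Type u} [CommRing S] (e : R ≃+* S)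
    (h : HasFiniteSelfInjectiveDimension R) : HasFiniteSelfInjectiveDimension S := by
  obtain ⟨d, hd⟩ := h
  let := RingHomInvPair.of_ringEquiv e
  let := RingHomInvPair.of_ringEquiv e.symm
  let l : (ModuleCat.of R R) ≃ₛₗ[RingHomClass.toRingHom e] (ModuleCat.of S S) :=
    { toFun := e
      invFun := e.symm
      map_add' := map_add e
      map_smul' := map_mul e
      left_inv := e.symm_apply_apply
      right_inv := e.apply_symm_apply }
  exact ⟨d, (ModuleCat.hasInjectiveDimensionLE_iff_of_semiLinearEquiv e l d).mp hd⟩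

lemma quotient_span_singleton {x : R} (hx : IsSMulRegular R x)
    (h : HasFiniteSelfInjectiveDimension R) :
    HasFiniteSelfInjectiveDimension (R ⧸ Ideal.span {x}) :=
  h.imp fun d hd => InjectiveDimensionQuotient.hasInjectiveDimensionLE_quotient hx d hd

open RingTheory.Sequence in
lemma quotient_ofList (rs : List R) (hrs : IsWeaklyRegular R rs)
    (h : HasFiniteSelfInjectiveDimension R) :
    HasFiniteSelfInjectiveDimension (R ⧸ Ideal.ofList rs) := by
  generalize hn : rs.length = n
  induction n generalizing R rs with
  | zero =>
    rw [List.length_eq_zero_iff] at hn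
    subst hn
    rw [Ideal.ofList_nil]
    exact h.of_ringEquiv (RingEquiv.quotientBot R).symm
  | succ n ih =>
    obtain ⟨x, rs, rfl⟩ := List.exists_cons_of_length_eq_add_one hn
    rw [isWeaklyRegular_cons_iff'] at hrs
    let e : QuotSMulTop x R ≃ₗ[R ⧸ Ideal.span {x}] R ⧸ Ideal.span {x} :=
      ((Submodule.quotEquivOfEq _ _ (by
        rw [← Submodule.ideal_span_singleton_smul, smul_eq_mul, Ideal.mul_top])) :
          QuotSMulTop x R ≃ₗ[R] R ⧸ Ideal.span {x}).extendScalarsOfSurjective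
            Ideal.Quotient.mk_surjective
    have h2 := (e.isWeaklyRegular_congr _).mp hrs.2
    have h3 := ih _ h2 (h.quotient_span_singleton hrs.1) (by simpa using hn)
    rw [Ideal.ofList_cons]
    rw [← Ideal.map_ofList] at h3
    exact h3.of_ringEquiv (DoubleQuot.quotQuotEquivQuotSup _ _)

end HasFiniteSelfInjectiveDimension


/-! ### Smooth algebras over complete intersections -/

namespace HasFiniteSelfInjectiveDimension

variable {R : Type u} [CommRing R]

lemma of_isLocalization [IsNoetherianRing R] (M : Submonoid R) {S : Type u} [CommRing S]
    [Algebra R S] [IsLocalization M S] (h : HasFiniteSelfInjectiveDimension R) :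
    HasFiniteSelfInjectiveDimension S := by
  obtain ⟨d, hd⟩ := h
  have h1 := (ModuleCat.of R R).localizedModule_hasInjectiveDimensionLE d M
  have := (ModuleCat.of R R).localizedModule_isLocalizedModule M
  let l : (ModuleCat.of R R).localizedModule M ≃ₗ[R] Localization M :=
    IsLocalizedModule.linearEquiv M ((ModuleCat.of R R).localizedModuleMkLinearMap M)
      (Algebra.linearMap R (Localization M))
  let l' : (ModuleCat.of R R).localizedModule M ≃ₗ[Localization M]
      ModuleCat.of (Localization M) (Localization M) :=
    l.extendScalarsOfIsLocalization M (Localization M)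
  have h2 : HasFiniteSelfInjectiveDimension (Localization M) :=
    ⟨d, (ModuleCat.hasInjectiveDimensionLE_iff_of_linearEquiv l' d).mp h1⟩
  exact h2.of_ringEquiv (IsLocalization.algEquiv M (Localization M) S).toRingEquiv

lemma adjoinRoot {f : Polynomial R} (hf : f.Monic)
    (h : HasFiniteSelfInjectiveDimension (Polynomial R)) :
    HasFiniteSelfInjectiveDimension (AdjoinRoot f) :=
  h.quotient_span_singleton hf.isRegular.left

open RingTheory.Sequence in
lemma polynomial_mvPolynomial_quotient {k : Type u} [Field k] {m : ℕ}
    (I : Ideal (MvPolynomial (Fin m) k)) (rs : List (MvPolynomial (Fin m) k))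
    (hrs : IsWeaklyRegular (MvPolynomial (Fin m) k) rs)
    (hI : I = Ideal.ofList rs) {B : Type u} [CommRing B]
    (e : (MvPolynomial (Fin m) k ⧸ I) ≃+* B) (n : ℕ) : HasFiniteSelfInjectiveDimension
      (Polynomial (MvPolynomial (Fin n) B)) := by
  let S := MvPolynomial (Fin m) k
  let P := MvPolynomial (Fin n) S
  have h0 : HasFiniteSelfInjectiveDimension (Polynomial P) :=
    ⟨_, (((HilbertSyzygy.GlobalDimLE.field k).mvPolynomial m).mvPolynomial
      n).polynomial.hasInjectiveDimensionLE _⟩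
  have h1 : IsWeaklyRegular P (rs.map (algebraMap S P)) := hrs.of_flat
  have h2 : IsWeaklyRegular (Polynomial P)
      ((rs.map (algebraMap S P)).map (algebraMap P (Polynomial P))) := h1.of_flat
  have h3 := h0.quotient_ofList _ h2
  rw [← Ideal.map_ofList, ← Ideal.map_ofList, ← hI] at h3
  have e1 := Ideal.polynomialQuotientEquivQuotientPolynomial (I.map (C (σ := Fin n)))
  have e2 : (P ⧸ I.map (C (σ := Fin n))) ≃+* MvPolynomial (Fin n) B :=
    (MvPolynomial.quotientEquivQuotientMvPolynomial (σ := Fin n) I).toRingEquiv.symm.trans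
      (MvPolynomial.mapEquiv (Fin n) e)
  exact (h3.of_ringEquiv e1.symm).of_ringEquiv (Polynomial.mapEquiv e2)

end HasFiniteSelfInjectiveDimension

lemma IsGorensteinLocalRing.of_ringEquiv {R S : Type u} [CommRing R] [CommRing S] (e : R ≃+* S)
    (h : IsGorensteinLocalRing R) : IsGorensteinLocalRing S := by
  obtain ⟨h1, h2, h3⟩ := h
  exact ⟨e.isLocalRing, isNoetherianRing_of_ringEquiv R e,
    HasFiniteSelfInjectiveDimension.of_ringEquiv e h3⟩

/-- If all `B[t₁, …, tₙ][X]` have finite injective dimension then the local rings of a smooth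
`B`-algebra are Gorenstein. -/
lemma isGorensteinLocalRing_atPrime_of_smooth {B E : Type u} [CommRing B] [CommRing E]
    [Algebra B E] [IsNoetherianRing B] [Algebra.Smooth B E]
    (hB : ∀ n : ℕ, HasFiniteSelfInjectiveDimension (Polynomial (MvPolynomial (Fin n) B)))
    (q : Ideal E) [q.IsPrime] : IsGorensteinLocalRing (Localization.AtPrime q) := by
  have : IsNoetherianRing E := Algebra.FiniteType.isNoetherianRing B E
  refine ⟨inferInstance, IsLocalization.isNoetherianRing q.primeCompl _ inferInstance, ?_⟩
  obtain ⟨f, hf, n, _, -, ⟨⟨P⟩⟩⟩ :=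
    Algebra.IsSmoothAt.exists_isStandardEtale_mvPolynomial (R := B) (p := q)
  have h1 : HasFiniteSelfInjectiveDimension (AdjoinRoot P.f) := (hB n).adjoinRoot P.monic_f
  have : IsNoetherianRing (AdjoinRoot P.f) :=
    inferInstanceAs (IsNoetherianRing (Polynomial (MvPolynomial (Fin n) B) ⧸ Ideal.span {P.f}))
  have h2 : HasFiniteSelfInjectiveDimension (Localization.Away (AdjoinRoot.mk P.f P.g)) :=
    h1.of_isLocalization (Submonoid.powers (AdjoinRoot.mk P.f P.g))
  have h3 : HasFiniteSelfInjectiveDimension (Localization.Away f) :=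
    h2.of_ringEquiv (P.equivRing.trans P.P.equivAwayAdjoinRoot).toRingEquiv.symm
  have hle : Submonoid.powers f ≤ q.primeCompl := Submonoid.powers_le.mpr hf
  let := IsLocalization.localizationAlgebraOfSubmonoidLe (Localization.Away f)
    (Localization.AtPrime q) (Submonoid.powers f) q.primeCompl hle
  have := IsLocalization.localization_isScalarTower_of_submonoid_le (Localization.Away f)
    (Localization.AtPrime q) (Submonoid.powers f) q.primeCompl hle
  have := IsLocalization.isLocalization_of_submonoid_le (Localization.Away f)
    (Localization.AtPrime q) (Submonoid.powers f) q.primeCompl hle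
  exact h3.of_isLocalization (q.primeCompl.map (algebraMap E (Localization.Away f)))


namespace RegularSequenceDepth

open RingTheory.Sequence IsLocalRing Pointwise Abelian Module

/-- There is an `M`-regular sequence of length `e` in the maximal ideal. -/
def DepthGE (R : Type u) [CommRing R] [IsLocalRing R] (M : Type u) [AddCommGroup M] [Module R M]
    (e : ℕ) : Prop :=
  ∃ rs : List R, rs.length = e ∧ (∀ r ∈ rs, r ∈ maximalIdeal R) ∧ IsRegular M rs

lemma maximalIdeal_smul_top_lt {R : Type u} [CommRing R] [IsLocalRing R]
    (M : Type u) [AddCommGroup M] [Module R M]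
    [Module.Finite R M] [Nontrivial M] : maximalIdeal R • (⊤ : Submodule R M) < ⊤ :=
  (Submodule.top_ne_ideal_smul_of_le_jacobson_annihilator (maximalIdeal_le_jacobson _)).symm.lt_top

lemma DepthGE.congr {R : Type u} [CommRing R] [IsLocalRing R]
    {M N : Type u} [AddCommGroup M] [Module R M] [AddCommGroup N] [Module R N]
    (f : M ≃ₗ[R] N) {e : ℕ} (h : DepthGE R M e) : DepthGE R N e := by
  obtain ⟨rs, h1, h2, h3⟩ := h
  exact ⟨rs, h1, h2, (f.isRegular_congr rs).mp h3⟩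

variable {R : Type u} [CommRing R] [IsNoetherianRing R] [IsLocalRing R]

lemma exists_associatedPrime_quotSMulTop {M : Type u} [AddCommGroup M] [Module R M]
    [Module.Finite R M] {x : R} (hx : x ∈ maximalIdeal R) (hreg : IsSMulRegular M x)
    {p : Ideal R} (hp : IsAssociatedPrime p M) :
    ∃ q : Ideal R, IsAssociatedPrime q (QuotSMulTop x M) ∧ p < q := by
  obtain ⟨hpp, y, hy⟩ := isAssociatedPrime_iff.mp hp
  let U : Submodule R M := Submodule.torsionBySet R M p
  have hyU : y ∈ U := by
    rw [Submodule.mem_torsionBySet_iff]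
    rintro ⟨a, ha⟩
    rw [SetLike.mem_coe, hy, Submodule.mem_colon_singleton] at ha
    simpa using ha
  have hy0 : y ≠ 0 := by
    rintro rfl
    exact hpp.ne_top (by rw [hy]; simp)
  have hU : U ≠ ⊥ := fun h => hy0 (by rw [h] at hyU; simpa using hyU)
  have hxU : ∃ u ∈ U, u ∉ x • U := by
    by_contra! h
    refine hU (Submodule.eq_bot_of_le_smul_of_le_jacobson_bot (Ideal.span {x}) U
      (IsNoetherian.noetherian U) ?_ ?_)
    · rw [Submodule.ideal_span_singleton_smul]
      exact h
    · rw [Ideal.span_singleton_le_iff_mem, IsLocalRing.jacobson_eq_maximalIdeal ⊥ bot_ne_top]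
      exact hx
  obtain ⟨u, huU, hu⟩ := hxU
  have hum : (Submodule.Quotient.mk u : QuotSMulTop x M) ≠ 0 := by
    rw [Ne, Submodule.Quotient.mk_eq_zero]
    intro h
    obtain ⟨v, -, rfl⟩ := (Submodule.mem_smul_pointwise_iff_exists _ _ _).mp h
    refine hu ((Submodule.mem_smul_pointwise_iff_exists _ _ _).mpr ⟨v, ?_, rfl⟩)
    rw [Submodule.mem_torsionBySet_iff] at huU ⊢
    intro a
    refine hreg (?_ : x • ((a : R) • v) = x • (0 : M))
    rw [smul_comm, smul_zero]
    exact huU a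
  obtain ⟨q, hq, hle⟩ := exists_le_isAssociatedPrime_of_isNoetherianRing R _ hum
  refine ⟨q, hq, lt_of_le_of_ne ?_ ?_⟩
  · intro a ha
    refine hle ?_
    rw [Submodule.mem_colon_singleton, Submodule.mem_bot, ← Submodule.Quotient.mk_smul]
    rw [Submodule.mem_torsionBySet_iff] at huU
    rw [show a • u = 0 from huU ⟨a, ha⟩, Submodule.Quotient.mk_zero]
  · rintro rfl
    have hxp : x ∈ p := by
      refine hle ?_
      rw [Submodule.mem_colon_singleton, Submodule.mem_bot, ← Submodule.Quotient.mk_smul,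
        Submodule.Quotient.mk_eq_zero]
      exact Submodule.smul_mem_pointwise_smul _ _ _ trivial
    rw [hy, Submodule.mem_colon_singleton, Submodule.mem_bot] at hxp
    exact hy0 (hreg (hxp.trans (smul_zero x).symm))

lemma length_le_coheight (rs : List R) : ∀ (M : Type u) [AddCommGroup M] [Module R M]
    [Module.Finite R M], (∀ r ∈ rs, r ∈ maximalIdeal R) → IsWeaklyRegular M rs →
    ∀ p : PrimeSpectrum R, IsAssociatedPrime p.asIdeal M → (rs.length : ℕ∞) ≤ Order.coheight p := by
  induction rs with
  | nil => intros; simp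
  | cons x rs ih =>
    intro M _ _ _ hmem hreg p hp
    rw [isWeaklyRegular_cons_iff] at hreg
    obtain ⟨q, hq, hlt⟩ := exists_associatedPrime_quotSMulTop (hmem x (by simp)) hreg.1 hp
    have h1 := ih (QuotSMulTop x M) (fun r hr => hmem r (by simp [hr])) hreg.2 ⟨q, hq.isPrime⟩ hq
    have h2 : Order.coheight (⟨q, hq.isPrime⟩ : PrimeSpectrum R) + 1 ≤ Order.coheight p :=
      Order.coheight_add_one_le hlt
    refine le_trans ?_ h2
    push_cast [List.length_cons]
    gcongr

lemma length_le_supportDim {M : Type u} [AddCommGroup M] [Module R M] [Module.Finite R M]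
    {rs : List R} (hmem : ∀ r ∈ rs, r ∈ maximalIdeal R) (hreg : IsWeaklyRegular M rs)
    {p : Ideal R} (hp : IsAssociatedPrime p M) :
    ((rs.length : ℕ∞) : WithBot ℕ∞) ≤ supportDim R (R ⧸ p) := by
  have h := length_le_coheight rs M hmem hreg ⟨p, hp.isPrime⟩ hp
  rw [supportDim_quotient_eq_ringKrullDim, ringKrullDim_quotient]
  have h2 : PrimeSpectrum.zeroLocus (p : Set R)
      = Set.Ici (⟨p, hp.isPrime⟩ : PrimeSpectrum R) := by
    ext q; simp [PrimeSpectrum.mem_zeroLocus, ← PrimeSpectrum.asIdeal_le_asIdeal]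
  rw [h2, ← Order.coheight_eq_krullDim_Ici]
  exact_mod_cast h

lemma supportDim_le_add_length (rs : List R) : ∀ (M : Type u) [AddCommGroup M] [Module R M]
    [Module.Finite R M], (∀ r ∈ rs, r ∈ maximalIdeal R) →
    supportDim R M ≤ supportDim R (M ⧸ (Ideal.ofList rs • ⊤ : Submodule R M)) + rs.length := by
  induction rs with
  | nil =>
    intro M _ _ _ _
    rw [← supportDim_eq_of_equiv (Submodule.quotEquivOfEqBot (Ideal.ofList [] • ⊤ : Submodule R M)
      (by simp)).symm]
    simp
  | cons x rs ih =>
    intro M _ _ _ hmem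
    rw [supportDim_eq_of_equiv (Submodule.quotOfListConsSMulTopEquivQuotSMulTopInner M x rs)]
    refine (supportDim_le_supportDim_quotSMulTop_succ (hmem x (by simp))).trans ?_
    refine (add_le_add_left (ih (QuotSMulTop x M) fun r hr => hmem r (by simp [hr])) 1).trans ?_
    rw [add_assoc]
    simp

lemma DepthGE.quotSMulTop {M : Type u} [AddCommGroup M] [Module R M] [Module.Finite R M]
    [Nontrivial M] {e : ℕ} (h : DepthGE R M (e + 1)) {x : R} (hx : x ∈ maximalIdeal R)
    (hreg : IsSMulRegular M x) : DepthGE R (QuotSMulTop x M) e := by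
  have hM := (ModuleCat.exists_isRegular_tfae (maximalIdeal R) (e + 1) (ModuleCat.of R M)
    (maximalIdeal_smul_top_lt M)).out 1 3
  have : Nontrivial (QuotSMulTop x M) := nontrivial_quotSMulTop_of_mem_maximalIdeal M hx
  have hQ := (ModuleCat.exists_isRegular_tfae (maximalIdeal R) e
    (ModuleCat.of R (QuotSMulTop x M)) (maximalIdeal_smul_top_lt _)).out 1 3
  have h_ext := hM.mpr h
  refine hQ.mp fun i hi => ?_
  have zero1 := AddCommGrpCat.isZero_of_iff_subsingleton.mpr (h_ext i (by omega))
  have zero2 := AddCommGrpCat.isZero_of_iff_subsingleton.mpr (h_ext (i + 1) (by omega))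
  exact AddCommGrpCat.subsingleton_of_isZero <| ShortComplex.Exact.isZero_of_both_zeros
    ((Ext.covariant_sequence_exact₃' _
      (IsSMulRegular.smulShortComplex_shortExact (M := ModuleCat.of R M) hreg)) i (i + 1) rfl)
    (zero1.eq_zero_of_src _) (zero2.eq_zero_of_tgt _)

lemma DepthGE.quot_ofList (fs : List R) : ∀ {M : Type u} [AddCommGroup M] [Module R M]
    [Module.Finite R M] [Nontrivial M] {e : ℕ}, DepthGE R M (e + fs.length) →
    (∀ r ∈ fs, r ∈ maximalIdeal R) → IsWeaklyRegular M fs →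
    DepthGE R (M ⧸ (Ideal.ofList fs • ⊤ : Submodule R M)) e := by
  induction fs with
  | nil =>
    intro M _ _ _ _ e h _ _
    exact h.congr (Submodule.quotEquivOfEqBot (Ideal.ofList [] • ⊤ : Submodule R M)
      (by simp)).symm
  | cons x rs ih =>
    intro M _ _ _ _ e h hmem hreg
    rw [isWeaklyRegular_cons_iff] at hreg
    have : Nontrivial (QuotSMulTop x M) :=
      nontrivial_quotSMulTop_of_mem_maximalIdeal M (hmem x (by simp))
    exact (ih (DepthGE.quotSMulTop (e := e + rs.length) (by simpa [add_assoc] using h)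
      (hmem x (by simp)) hreg.1) (fun r hr => hmem r (by simp [hr])) hreg.2).congr
      (Submodule.quotOfListConsSMulTopEquivQuotSMulTopInner M x rs).symm

/-- In a module of depth at least `e`, a sequence that cuts the dimension down to at most
`e` minus its length is weakly regular. -/
theorem isWeaklyRegular_of_supportDim_le (fs : List R) : ∀ (M : Type u) [AddCommGroup M]
    [Module R M] [Module.Finite R M] [Nontrivial M] {e : ℕ}, DepthGE R M e →
    (∀ r ∈ fs, r ∈ maximalIdeal R) →
    supportDim R (M ⧸ (Ideal.ofList fs • ⊤ : Submodule R M)) + fs.length ≤ e →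
    IsWeaklyRegular M fs := by
  induction fs with
  | nil => intros; simp
  | cons x fs ih =>
    intro M _ _ _ _ e h hmem hdim
    have hx := hmem x (by simp)
    have : Nontrivial (QuotSMulTop x M) := nontrivial_quotSMulTop_of_mem_maximalIdeal M hx
    have hne : supportDim R (M ⧸ (Ideal.ofList (x :: fs) • ⊤ : Submodule R M)) ≠ ⊥ := by
      rw [supportDim_ne_bot_iff_nontrivial]
      exact Submodule.Quotient.nontrivial_iff.mpr
        (Submodule.top_ne_ideal_smul_of_le_jacobson_annihilator
        ((Ideal.span_le.mpr hmem).trans (maximalIdeal_le_jacobson _))).symm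
    have hreg : IsSMulRegular M x := by
      by_contra hn
      have hz : x ∈ {r : R | ∃ y : M, y ≠ 0 ∧ r • y = 0} := by
        by_contra hc
        refine hn (isSMulRegular_iff_right_eq_zero_of_smul.mpr fun y hy => ?_)
        by_contra hy0
        exact hc ⟨y, hy0, hy⟩
      rw [← biUnion_associatedPrimes_eq_zero_divisors] at hz
      simp only [Set.mem_iUnion] at hz
      obtain ⟨p, hp, hxp⟩ := hz
      obtain ⟨rs, hl, hrm, hrs⟩ := h
      have h1 := length_le_supportDim hrm hrs.toIsWeaklyRegular hp
      have h2 := supportDim_le_add_length fs (R ⧸ p) fun r hr => hmem r (by simp [hr])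
      have h3 : supportDim R ((R ⧸ p) ⧸ (Ideal.ofList fs • ⊤ : Submodule R (R ⧸ p)))
          ≤ supportDim R (M ⧸ (Ideal.ofList (x :: fs) • ⊤ : Submodule R M)) := by
        have hsub : support R ((R ⧸ p) ⧸ (Ideal.ofList fs • ⊤ : Submodule R (R ⧸ p))) ⊆
            support R (M ⧸ (Ideal.ofList (x :: fs) • ⊤ : Submodule R M)) := by
          rw [support_quotient, support_quotient]
          obtain ⟨_, f, hf⟩ := (isAssociatedPrime_iff_exists_injective_linearMap p M).mp hp
          rintro q ⟨hq1, hq2⟩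
          refine ⟨support_subset_of_injective f hf hq1, ?_⟩
          rw [support_eq_zeroLocus, Ideal.annihilator_quotient, PrimeSpectrum.mem_zeroLocus] at hq1
          rw [PrimeSpectrum.mem_zeroLocus] at hq2 ⊢
          rw [Ideal.ofList_cons]
          exact sup_le ((Ideal.span_singleton_le_iff_mem _).mpr (hq1 hxp)) hq2
        exact Order.krullDim_le_of_strictMono (fun a => ⟨a.1, hsub a.2⟩) fun {_ _} lt => lt
      have h4 := h1.trans (h2.trans (add_le_add_left h3 _))
      rw [hl] at h4
      generalize supportDim R (M ⧸ (Ideal.ofList (x :: fs) • ⊤ : Submodule R M)) = D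
        at h4 hne hdim
      induction D with
      | bot => exact hne rfl
      | coe D =>
        induction D with
        | top => exact absurd hdim (by
            rw [not_le]
            exact_mod_cast (ENat.natCast_lt_top e))
        | coe D =>
          have a1 : D + (fs.length + 1) ≤ e := by exact_mod_cast hdim
          have a2 : e ≤ D + fs.length := by exact_mod_cast h4
          omega
    refine IsWeaklyRegular.cons hreg ?_
    rcases e with _ | e
    · exfalso
      generalize supportDim R (M ⧸ (Ideal.ofList (x :: fs) • ⊤ : Submodule R M)) = D
        at hne hdim
      induction D with
      | bot => exact hne rfl
      | coe D =>
        have : D + (fs.length + 1 : ℕ) ≤ (0 : ℕ) := by exact_mod_cast hdim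
        simp at this
    · refine ih (QuotSMulTop x M) (h.quotSMulTop hx hreg) (fun r hr => hmem r (by simp [hr])) ?_
      rw [← supportDim_eq_of_equiv (Submodule.quotOfListConsSMulTopEquivQuotSMulTopInner M x fs)]
      have h5 : supportDim R (M ⧸ (Ideal.ofList (x :: fs) • ⊤ : Submodule R M)) + fs.length + 1
          ≤ (e : WithBot ℕ∞) + 1 := by
        rw [add_assoc]
        exact_mod_cast hdim
      generalize supportDim R (M ⧸ (Ideal.ofList (x :: fs) • ⊤ : Submodule R M)) = D
        at hne h5 ⊢
      induction D with
      | bot => exact absurd rfl hne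
      | coe D =>
        have a1 : D + (fs.length : ℕ) + 1 ≤ (e : ℕ∞) + 1 := by exact_mod_cast h5
        exact_mod_cast (ENat.add_le_add_iff_right (by simp)).mp a1

end RegularSequenceDepth

namespace OriginLocalization

open RingTheory.Sequence RegularSequenceDepth IsLocalRing Module

variable {k : Type u} [Field k] {N : ℕ}

lemma isWeaklyRegular_X :
    IsWeaklyRegular (MvPolynomial (Fin N) k) (List.ofFn fun i : Fin N => X (R := k) i) := by
  rw [isWeaklyRegular_iff]
  intro i hi
  rw [isSMulRegular_quotient_iff_mem_of_smul_mem]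
  have hi' : i < N := by simpa using hi
  have hset : Ideal.ofList ((List.ofFn fun i : Fin N => X (R := k) i).take i)
      = Ideal.span ((X : Fin N → MvPolynomial (Fin N) k) '' {j | j.1 < i}) := by
    rw [Ideal.ofList]
    congr 1
    ext F
    simp only [Set.mem_ofPred_eq, Set.mem_image, List.mem_take_iff_getElem, List.getElem_ofFn,
      List.length_ofFn]
    constructor
    · rintro ⟨j, hj, rfl⟩
      exact ⟨⟨j, by omega⟩, by simp; omega, rfl⟩
    · rintro ⟨j, hj, rfl⟩
      exact ⟨j, by simp only [lt_min_iff]; exact ⟨hj, j.2⟩, rfl⟩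
  intro f hf
  rw [Ideal.smul_eq_mul, Ideal.mul_top, hset, mem_ideal_span_X_image] at hf ⊢
  intro s hs
  have h1 : s + Finsupp.single ⟨i, hi'⟩ 1 ∈ ((X ⟨i, hi'⟩ : MvPolynomial (Fin N) k) * f).support := by
    rw [MvPolynomial.mem_support_iff, coeff_X_mul', if_pos (by simp)]
    simpa using hs
  obtain ⟨j, hj, hne⟩ := hf _ (by simpa using h1)
  refine ⟨j, hj, ?_⟩
  have : (⟨i, hi'⟩ : Fin N) ≠ j := by
    rintro rfl
    simp at hj
  simpa [Finsupp.single_apply, this] using hne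

/-- The homogeneous maximal ideal of a polynomial ring. -/
abbrev originIdeal (k : Type u) [Field k] (N : ℕ) : Ideal (MvPolynomial (Fin N) k) :=
  RingHom.ker (constantCoeff : MvPolynomial (Fin N) k →+* k)

instance : (originIdeal k N).IsMaximal :=
  RingHom.ker_isMaximal_of_surjective _ fun c => ⟨C c, by simp⟩

lemma originIdeal_eq_span : originIdeal k N = Ideal.span (Set.range X) := by
  refine le_antisymm (fun F hF => ?_) (Ideal.span_le.mpr ?_)
  · rw [← Set.image_univ, mem_ideal_span_X_image]
    intro s hs
    rw [RingHom.mem_ker, constantCoeff_eq] at hF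
    have hs0 : s ≠ 0 := by
      rintro rfl
      exact MvPolynomial.mem_support_iff.mp hs hF
    obtain ⟨i, hi⟩ := Finsupp.ne_iff.mp hs0
    exact ⟨i, trivial, hi⟩
  · rintro _ ⟨i, rfl⟩
    simp

/-- The local ring of affine space at the origin. -/
abbrev OriginRing (k : Type u) [Field k] (N : ℕ) : Type u := Localization.AtPrime (originIdeal k N)

lemma mem_of_mul_mem {I : Ideal (MvPolynomial (Fin N) k)}
    (hI : I.IsHomogeneous (homogeneousSubmodule (Fin N) k)) {s g : MvPolynomial (Fin N) k}
    (hs : constantCoeff s ≠ 0) (h : s * g ∈ I) : g ∈ I := by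
  rw [mem_iff_homogeneousComponent_mem hI]
  intro d
  induction d using Nat.strong_induction_on with
  | _ d ih =>
    have h1 := homogeneousComponent_mem_of_mem hI h d
    have h2 : homogeneousComponent d (s * g) = ∑ ij ∈ Finset.HasAntidiagonal.antidiagonal d,
        homogeneousComponent ij.1 s * homogeneousComponent ij.2 g := by
      have h3 := DirectSum.coe_mul_apply_eq_sum_antidiagonal (homogeneousSubmodule (Fin N) k)
        (DirectSum.decompose (homogeneousSubmodule (Fin N) k) s)
        (DirectSum.decompose (homogeneousSubmodule (Fin N) k) g) d
      rw [← DirectSum.decompose_mul] at h3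
      have h4 : ∀ (F : MvPolynomial (Fin N) k) (e : ℕ),
          (DirectSum.decompose (homogeneousSubmodule (Fin N) k) F e : MvPolynomial (Fin N) k)
          = homogeneousComponent e F := fun F e => decomposition.decompose'_apply F e
      simpa only [h4] using h3
    rw [h2, ← Finset.sum_erase_add _ _ (Finset.HasAntidiagonal.mem_antidiagonal.mpr (zero_add d) :
      ((0, d) : ℕ × ℕ) ∈ _), homogeneousComponent_zero] at h1
    have h5 := (I.add_mem_iff_right (I.sum_mem fun ij hij => ?_)).mp h1
    · have h6 := I.mul_mem_left (C (constantCoeff s)⁻¹) h5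
      rwa [← mul_assoc, ← C_mul, ← constantCoeff_eq, inv_mul_cancel₀ hs, C_1, one_mul] at h6
    · rw [Finset.mem_erase, Finset.HasAntidiagonal.mem_antidiagonal] at hij
      refine I.mul_mem_left _ (ih _ ?_)
      by_contra hlt
      exact hij.1 (Prod.ext (by simp; omega) (by simp; omega))

lemma algebraMap_mem_map_iff {I : Ideal (MvPolynomial (Fin N) k)}
    (hI : I.IsHomogeneous (homogeneousSubmodule (Fin N) k)) {g : MvPolynomial (Fin N) k} :
    algebraMap _ (OriginRing k N) g ∈ I.map (algebraMap _ (OriginRing k N)) ↔ g ∈ I := by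
  rw [IsLocalization.algebraMap_mem_map_algebraMap_iff (originIdeal k N).primeCompl]
  exact ⟨fun ⟨s, hs, h⟩ => mem_of_mul_mem hI hs h, fun h => ⟨1, one_mem _, by simpa⟩⟩

lemma isHomogeneous_ofList {Fs : List (MvPolynomial (Fin N) k)}
    (hF : ∀ F ∈ Fs, ∃ d, F.IsHomogeneous d) :
    (Ideal.ofList Fs).IsHomogeneous (homogeneousSubmodule (Fin N) k) :=
  Ideal.homogeneous_span _ _ fun F h => hF F h

lemma isWeaklyRegular_of_map {Fs : List (MvPolynomial (Fin N) k)}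
    (hF : ∀ F ∈ Fs, ∃ d, F.IsHomogeneous d)
    (h : IsWeaklyRegular (OriginRing k N) (Fs.map (algebraMap _ (OriginRing k N)))) :
    IsWeaklyRegular (MvPolynomial (Fin N) k) Fs := by
  rw [isWeaklyRegular_iff] at h ⊢
  intro i hi
  have h1 := h i (by simpa using hi)
  rw [isSMulRegular_quotient_iff_mem_of_smul_mem] at h1 ⊢
  intro g hg
  have hh := isHomogeneous_ofList (Fs := Fs.take i) fun F hF' => hF F (List.mem_of_mem_take hF')
  have h2 := h1 (algebraMap _ _ g)
  simp only [Ideal.mul_top, ← List.map_take, ← Ideal.map_ofList, smul_eq_mul,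
    List.getElem_map, ← map_mul, algebraMap_mem_map_iff hh] at h2 hg ⊢
  exact h2 hg

lemma map_mem_maximalIdeal {Fs : List (MvPolynomial (Fin N) k)}
    (hF : ∀ F ∈ Fs, F ∈ originIdeal k N) :
    ∀ r ∈ Fs.map (algebraMap _ (OriginRing k N)), r ∈ maximalIdeal (OriginRing k N) := by
  intro r hr
  obtain ⟨F, h, rfl⟩ := List.mem_map.mp hr
  exact (IsLocalization.AtPrime.to_map_mem_maximal_iff _ (originIdeal k N) F).mpr (hF F h)

lemma depthGE_originRing : DepthGE (OriginRing k N) (OriginRing k N) N := by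
  have hm : ∀ F ∈ List.ofFn fun i : Fin N => X (R := k) i, F ∈ originIdeal k N := by
    intro F hF
    obtain ⟨i, rfl⟩ := List.mem_ofFn.mp hF
    simp
  exact ⟨_, by simp, map_mem_maximalIdeal hm,
    isWeaklyRegular_X.isRegular_of_isLocalization_of_mem _ (originIdeal k N) hm⟩

lemma height_originIdeal_le : (originIdeal k N).height ≤ N := by
  have h := Ideal.height_le_ringKrullDim_of_isPrime (I := originIdeal k N)
  rw [MvPolynomial.ringKrullDim_of_isNoetherianRing, ringKrullDim_eq_zero_of_field] at h
  exact_mod_cast (by simpa using h : ((originIdeal k N).height : WithBot ℕ∞) ≤ N)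

lemma ringKrullDim_quotient_add_height_le {A : Type u} [CommRing A] (P : Ideal A) [P.IsPrime] :
    ringKrullDim (A ⧸ P) + P.height ≤ ringKrullDim A := by
  have h2 : PrimeSpectrum.zeroLocus (P : Set A)
      = Set.Ici (⟨P, inferInstance⟩ : PrimeSpectrum A) := by
    ext q; simp [PrimeSpectrum.mem_zeroLocus, ← PrimeSpectrum.asIdeal_le_asIdeal]
  have : Nonempty (PrimeSpectrum A) := ⟨⟨P, inferInstance⟩⟩
  rw [ringKrullDim_quotient, h2, ← Order.coheight_eq_krullDim_Ici, ringKrullDim,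
    Order.krullDim_eq_iSup_height_add_coheight_of_nonempty,
    PrimeSpectrum.height_eq_orderHeight ⟨P, inferInstance⟩, add_comm]
  exact_mod_cast le_iSup (fun a : PrimeSpectrum A => Order.height a + Order.coheight a)
    ⟨P, inferInstance⟩

lemma isWeaklyRegular_map {Fs : List (MvPolynomial (Fin N) k)}
    (hF : ∀ F ∈ Fs, F ∈ originIdeal k N) [(Ideal.ofList Fs).IsPrime]
    (hh : (Ideal.ofList Fs).height = Fs.length) :
    IsWeaklyRegular (OriginRing k N) (Fs.map (algebraMap _ (OriginRing k N))) := by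
  refine isWeaklyRegular_of_supportDim_le _ _ depthGE_originRing (map_mem_maximalIdeal hF) ?_
  rw [Ideal.smul_eq_mul, Ideal.mul_top, supportDim_quotient_eq_ringKrullDim, ← Ideal.map_ofList,
    List.length_map]
  have hle : Ideal.ofList Fs ≤ originIdeal k N := Ideal.span_le.mpr hF
  have hd : Disjoint ((originIdeal k N).primeCompl : Set (MvPolynomial (Fin N) k))
      (Ideal.ofList Fs : Set (MvPolynomial (Fin N) k)) :=
    Set.disjoint_left.mpr fun a ha hb => ha (hle hb)
  have := IsLocalization.isPrime_of_isPrime_disjoint (originIdeal k N).primeCompl (OriginRing k N)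
    (Ideal.ofList Fs) ‹_› hd
  have h1 := ringKrullDim_quotient_add_height_le
    ((Ideal.ofList Fs).map (algebraMap _ (OriginRing k N)))
  rw [IsLocalization.height_map_of_disjoint (originIdeal k N).primeCompl _ hd, hh,
    IsLocalization.AtPrime.ringKrullDim_eq_height (originIdeal k N) (OriginRing k N)] at h1
  exact h1.trans (by exact_mod_cast height_originIdeal_le)

/-- Homogeneous generators of a prime ideal, as many as its height, form a regular sequence. -/
theorem isWeaklyRegular_of_height_eq {Fs : List (MvPolynomial (Fin N) k)}
    (hF : ∀ F ∈ Fs, ∃ d, 0 < d ∧ F.IsHomogeneous d) [(Ideal.ofList Fs).IsPrime]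
    (hh : (Ideal.ofList Fs).height = Fs.length) :
    IsWeaklyRegular (MvPolynomial (Fin N) k) Fs := by
  refine isWeaklyRegular_of_map (fun F h => ?_) (isWeaklyRegular_map (fun F h => ?_) hh)
  · obtain ⟨d, -, hd⟩ := hF F h
    exact ⟨d, hd⟩
  · obtain ⟨d, hd0, hd⟩ := hF F h
    rw [RingHom.mem_ker, constantCoeff_eq]
    exact hd.coeff_eq_zero (by simpa using hd0.ne)

/-- A regular sequence of at most `N - 1` forms in `N` variables generates a saturated ideal. -/
theorem irrelevantSaturation_le {Fs : List (MvPolynomial (Fin N) k)}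
    (hF : ∀ F ∈ Fs, ∃ d, 0 < d ∧ F.IsHomogeneous d)
    (hreg : IsWeaklyRegular (MvPolynomial (Fin N) k) Fs) (hlt : Fs.length < N) :
    irrelevantSaturation (Ideal.ofList Fs) ≤ Ideal.ofList Fs := by
  have hF' : ∀ F ∈ Fs, F ∈ originIdeal k N := by
    intro F h
    obtain ⟨d, hd0, hd⟩ := hF F h
    rw [RingHom.mem_ker, constantCoeff_eq]
    exact hd.coeff_eq_zero (by simpa using hd0.ne)
  have hhom := isHomogeneous_ofList fun F h => let ⟨d, _, hd⟩ := hF F h; ⟨d, hd⟩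
  have hreg' := hreg.of_isLocalization (OriginRing k N) (originIdeal k N).primeCompl
  obtain ⟨rs, hl, hm, hrs⟩ := DepthGE.quot_ofList (Fs.map (algebraMap _ (OriginRing k N)))
    (M := OriginRing k N) (e := N - Fs.length)
    (by rw [List.length_map, Nat.sub_add_cancel hlt.le]; exact depthGE_originRing)
    (map_mem_maximalIdeal hF') hreg'
  rcases rs with _ | ⟨x, rs⟩
  · simp at hl; omega
  have hx := ((isWeaklyRegular_cons_iff _ _ _).mp hrs.toIsWeaklyRegular).1
  have hxm := hm x (by simp)
  intro G hG
  rw [← algebraMap_mem_map_iff hhom]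
  choose e he using hG
  obtain ⟨M, hM⟩ : ∃ M, originIdeal k N ^ M ≤ (Ideal.ofList Fs).colon {G} := by
    have h1 : originIdeal k N ≤ ((Ideal.ofList Fs).colon {G}).radical := by
      rw [originIdeal_eq_span, Ideal.span_le]
      rintro _ ⟨i, rfl⟩
      exact ⟨e i, by rw [Submodule.mem_colon_singleton]; exact he i⟩
    exact Ideal.exists_pow_le_of_le_radical_of_fg h1 (IsNoetherian.noetherian _)
  have hxM : x ^ M • algebraMap _ (OriginRing k N) G ∈
      (Ideal.ofList Fs).map (algebraMap _ (OriginRing k N)) := by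
    have h1 : x ^ M ∈ ((originIdeal k N) ^ M).map (algebraMap _ (OriginRing k N)) := by
      rw [Ideal.map_pow, IsLocalization.AtPrime.map_eq_maximalIdeal]
      exact Ideal.pow_mem_pow hxm M
    have h2 : ((originIdeal k N) ^ M).map (algebraMap _ (OriginRing k N)) ≤
        ((Ideal.ofList Fs).map (algebraMap _ (OriginRing k N))).colon
          {algebraMap _ (OriginRing k N) G} := by
      rw [Ideal.map_le_iff_le_comap]
      intro a ha
      rw [Ideal.mem_comap, Submodule.mem_colon_singleton, smul_eq_mul, ← map_mul]
      exact Ideal.mem_map_of_mem _ (Submodule.mem_colon_singleton.mp (hM ha))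
    exact Submodule.mem_colon_singleton.mp (h2 h1)
  have hxp := hx.pow M
  rw [isSMulRegular_quotient_iff_mem_of_smul_mem] at hxp
  have := hxp (algebraMap _ _ G)
  rw [Ideal.smul_eq_mul, Ideal.mul_top, ← Ideal.map_ofList] at this
  exact this hxM

end OriginLocalization

namespace ProjSubscheme

open RingTheory.Sequence OriginLocalization TopologicalSpace

variable {k : Type u} [Field k]

lemma exists_asHomogeneousIdeal_ne_bot {σ : Type} (T : ProjSubscheme k σ) (hT : 0 < T.dim) :
    ∃ x : ProjectiveSpectrum T.grading, x.asHomogeneousIdeal ≠ ⊥ := by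
  have h0 : 0 < Order.krullDim (IrreducibleCloseds T.toScheme) := hT
  rw [Order.krullDim_pos_iff] at h0
  obtain ⟨Z₀, Z₁, hlt⟩ := h0
  let x₀ : ProjectiveSpectrum T.grading := Z₀.isIrreducible.genericPoint
  let x₁ : ProjectiveSpectrum T.grading := Z₁.isIrreducible.genericPoint
  have hx₀ : closure {x₀} = (Z₀ : Set T.toScheme) :=
    (Z₀.isIrreducible.isGenericPoint_genericPoint Z₀.isClosed).def
  have hx₁ : closure {x₁} = (Z₁ : Set T.toScheme) :=
    (Z₁.isIrreducible.isGenericPoint_genericPoint Z₁.isClosed).def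
  have hle : x₁ ≤ x₀ := by
    rw [ProjectiveSpectrum.le_iff_mem_closure]
    have h1 : x₀ ∈ (Z₀ : Set T.toScheme) := hx₀ ▸ subset_closure rfl
    have h2 : x₀ ∈ (Z₁ : Set T.toScheme) := hlt.le h1
    rw [← hx₁] at h2
    exact h2
  refine ⟨x₀, fun hbot => ?_⟩
  have heq : x₁ = x₀ := by
    apply ProjectiveSpectrum.ext
    exact le_antisymm ((ProjectiveSpectrum.as_ideal_le_as_ideal _ _ _).mpr hle) (hbot ▸ bot_le)
  refine hlt.ne (IrreducibleCloseds.ext ?_)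
  rw [← hx₀, ← hx₁, heq]

lemma exists_isPrime_lt_originIdeal {N : ℕ} (W : ProjSubscheme k (Fin N)) (hdim : 0 < W.dim) :
    ∃ q : Ideal (MvPolynomial (Fin N) k), q.IsPrime ∧ W.ideal < q ∧ q < originIdeal k N := by
  obtain ⟨x, hx⟩ := W.exists_asHomogeneousIdeal_ne_bot hdim
  have hxp : x.asHomogeneousIdeal.toIdeal.IsPrime := x.isPrime
  refine ⟨x.asHomogeneousIdeal.toIdeal.comap W.mk, Ideal.comap_isPrime _ _,
    lt_of_le_of_ne (fun F hF => ?_) fun h => hx ?_, lt_of_le_of_ne (fun F hF => ?_) fun h => ?_⟩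
  · rw [Ideal.mem_comap, W.mk_eq_zero_iff.mpr hF]
    exact Ideal.zero_mem _
  · rw [eq_bot_iff]
    intro a ha
    obtain ⟨F, rfl⟩ := W.mk_surjective a
    have hF : F ∈ W.ideal := by rw [h]; exact ha
    rw [W.mk_eq_zero_iff.mpr hF]
    exact Ideal.zero_mem _
  · rw [RingHom.mem_ker]
    by_contra hc
    have h0 := x.asHomogeneousIdeal.isHomogeneous 0 hF
    have h1 : (DirectSum.decompose W.grading (W.mk F) 0 : W.coordRing)
        = W.mk (homogeneousComponent 0 F) :=
      congrArg W.mk (decomposition.decompose'_apply (R := k) F 0)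
    rw [h1, homogeneousComponent_zero, ← constantCoeff_eq] at h0
    refine hxp.ne_top (Ideal.eq_top_of_isUnit_mem _ h0 ?_)
    exact ((isUnit_iff_ne_zero.mpr hc).map (C : k →+* MvPolynomial (Fin N) k)).map W.mk
  · refine x.not_irrelevant_le fun a ha => ?_
    obtain ⟨F, rfl⟩ := W.mk_surjective a
    have ha' : (DirectSum.decompose W.grading (W.mk F) 0 : W.coordRing) = 0 := by
      simpa [HomogeneousIdeal.mem_irrelevant_iff, GradedRing.proj_apply] using ha
    have h1 : (DirectSum.decompose W.grading (W.mk F) 0 : W.coordRing)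
        = W.mk (homogeneousComponent 0 F) :=
      congrArg W.mk (decomposition.decompose'_apply (R := k) F 0)
    have h2 : F - homogeneousComponent 0 F ∈ originIdeal k N := by
      rw [RingHom.mem_ker, homogeneousComponent_zero, map_sub, constantCoeff_C,
        constantCoeff_eq, sub_self]
    rw [← h, Ideal.mem_comap, map_sub, ← h1, ha', sub_zero] at h2
    exact h2

lemma height_add_two_le {N : ℕ} (W : ProjSubscheme k (Fin N)) (hW : W.IsVariety)
    (hdim : 0 < W.dim) {r : ℕ} (hr : W.ideal.height = r) : r + 2 ≤ N := by
  obtain ⟨q, hq, h1, h2⟩ := W.exists_isPrime_lt_originIdeal hdim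
  have : W.ideal.IsPrime := hW
  have h3 : ((r + 2 : ℕ) : ℕ∞) ≤ N :=
    calc ((r + 2 : ℕ) : ℕ∞) = W.ideal.height + 1 + 1 := by rw [hr]; push_cast; ring
      _ ≤ q.height + 1 := by gcongr; exact Ideal.height_add_one_le_of_lt_of_isPrime h1
      _ ≤ (originIdeal k N).height := Ideal.height_add_one_le_of_lt_of_isPrime h2
      _ ≤ N := height_originIdeal_le
  exact_mod_cast h3

lemma IsCompleteIntersection.exists_list {N : ℕ} {W : ProjSubscheme k (Fin N)}
    (hci : W.IsCompleteIntersection) : ∃ Fs : List (MvPolynomial (Fin N) k),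
      (∀ F ∈ Fs, ∃ d, 0 < d ∧ F.IsHomogeneous d) ∧ W.ideal = Ideal.ofList Fs ∧
        W.ideal.height = Fs.length := by
  obtain ⟨r, F, hF, hI, hh⟩ := hci
  refine ⟨List.ofFn F, ?_, ?_, by simpa using hh⟩
  · intro G hG
    obtain ⟨i, rfl⟩ := List.mem_ofFn.mp hG
    exact hF i
  · rw [hI, Ideal.ofList]
    congr 1
    ext G
    simp [List.mem_ofFn]

/-- The hyperplane sections of a positive dimensional complete intersection variety are defined by
the obvious equations. -/
theorem IsCompleteIntersection.sup_span_singleton_saturated {N : ℕ} {W : ProjSubscheme k (Fin N)}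
    (hci : W.IsCompleteIntersection) (hW : W.IsVariety) (hdim : 0 < W.dim)
    {l : MvPolynomial (Fin N) k} (hl : l.IsHomogeneous 1) (hlW : l ∉ W.ideal) :
    irrelevantSaturation (W.ideal ⊔ Ideal.span {l}) ≤ W.ideal ⊔ Ideal.span {l} := by
  obtain ⟨Fs, hF, hI, hh⟩ := hci.exists_list
  have hr := W.height_add_two_le hW hdim hh
  have hp : W.ideal.IsPrime := hW
  rw [hI] at hh hp hlW ⊢
  have hreg := isWeaklyRegular_of_height_eq hF hh
  rw [← Ideal.ofList_singleton, ← Ideal.ofList_append]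
  refine irrelevantSaturation_le ?_ ?_ (by simp; omega)
  · intro G hG
    rcases List.mem_append.mp hG with h | h
    · exact hF G h
    · rw [List.mem_singleton.mp h]
      exact ⟨1, one_pos, hl⟩
  · rw [isWeaklyRegular_append_iff, isWeaklyRegular_singleton_iff,
      isSMulRegular_quotient_iff_mem_of_smul_mem]
    refine ⟨hreg, fun G hG => ?_⟩
    rw [Ideal.smul_eq_mul, Ideal.mul_top] at hG ⊢
    exact (hp.mem_or_mem hG).resolve_left hlW

theorem IsCompleteIntersection.hasFiniteSelfInjectiveDimension {N : ℕ}
    {W : ProjSubscheme k (Fin N)} (hci : W.IsCompleteIntersection) (hW : W.IsVariety) (n : ℕ) :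
    HasFiniteSelfInjectiveDimension (Polynomial (MvPolynomial (Fin n) W.coordRing)) := by
  obtain ⟨Fs, hF, hI, hh⟩ := hci.exists_list
  have hp : (Ideal.ofList Fs).IsPrime := hI ▸ hW
  exact HasFiniteSelfInjectiveDimension.polynomial_mvPolynomial_quotient W.ideal Fs
    (isWeaklyRegular_of_height_eq hF (hI ▸ hh)) hI (RingEquiv.refl W.coordRing) n

end ProjSubscheme

lemma MvPolynomial.IsHomogeneous.aeval_mul {k : Type*} [CommRing k] {E : Type*} [CommRing E]
    [Algebra k E] {ι : Type*} {F : MvPolynomial ι k} {d : ℕ} (hF : F.IsHomogeneous d) (c : E)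
    (w : ι → E) : MvPolynomial.aeval (fun i => c * w i) F = c ^ d * MvPolynomial.aeval w F := by
  rw [aeval_def, aeval_def, eval₂_eq, eval₂_eq, Finset.mul_sum]
  refine Finset.sum_congr rfl fun s hs => ?_
  have hd : ∑ i ∈ s.support, s i = d := by
    have := hF (MvPolynomial.mem_support_iff.mp hs)
    rw [← this, Finsupp.weight_apply, Finsupp.sum]
    simp
  simp only [mul_pow, Finset.prod_mul_distrib, Finset.prod_pow_eq_pow_sum, hd]
  ring

namespace ProjSubscheme

variable {k : Type u} [Field k] {σ τ : Type}

lemma mk_homogeneousComponent (T : ProjSubscheme k τ) (d : ℕ) (F : MvPolynomial τ k) :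
    GradedAlgebra.proj T.grading d (T.mk F) = T.mk (homogeneousComponent d F) :=
  congrArg T.mk (decomposition.decompose'_apply (R := k) F d)

section Point

variable (p : ℙ k (σ → k)) (T : ProjSubscheme k τ)

/-- The map `z_{ij} ↦ p_i y_j` of coordinate rings given by the inclusion of `{p} × P^m`. -/
def pointFibre (p : ℙ k (σ → k)) : MvPolynomial (σ × τ) k →ₐ[k] MvPolynomial τ k :=
  aeval fun ij => C (p.rep ij.1) * X ij.2

lemma pointFibre_mem_of_mem_ker {F : MvPolynomial (σ × τ) k}
    (hF : (point p).segreHom T F = 0) : pointFibre p F ∈ T.ideal := by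
  let ev : (point p).coordRing →ₐ[k] k := Ideal.Quotient.liftₐ (point p).ideal (aeval p.rep)
    fun G hG => eval_eq_zero_of_mem_pointIdeal p hG
  have hev : ∀ i, ev ((point p).mk (X i)) = p.rep i := fun i => aeval_X (R := k) p.rep i
  let Φ : (point p).coordRing ⊗[k] T.coordRing →ₐ[k] T.coordRing :=
    Algebra.TensorProduct.lift ((Algebra.ofId k T.coordRing).comp ev) (AlgHom.id k _)
      fun _ _ => Commute.all _ _
  have h : Φ.comp ((point p).segreHom T) = T.mk.comp (pointFibre p) := by
    refine algHom_ext fun ij => ?_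
    simp only [AlgHom.comp_apply, segreHom, pointFibre, aeval_X, Φ, map_mul,
      Algebra.TensorProduct.lift_tmul, AlgHom.id_apply, hev]
    rfl
  rw [← T.mk_eq_zero_iff]
  have h2 := DFunLike.congr_fun h F
  rw [AlgHom.comp_apply, AlgHom.comp_apply, hF, map_zero] at h2
  exact h2.symm

lemma mem_ker_of_pointFibre_mem {F : MvPolynomial (σ × τ) k}
    (hF : pointFibre p F ∈ T.ideal) : (point p).segreHom T F = 0 := by
  obtain ⟨i, hi⟩ : ∃ i, p.rep i ≠ 0 := by
    by_contra! h
    exact p.rep_nonzero (funext h)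
  let c : (point p).coordRing := (p.rep i)⁻¹ • (point p).mk (X i)
  have hc : ∀ j, (point p).mk (X j) = p.rep j • c := by
    intro j
    rw [← sub_eq_zero, smul_smul, ← map_smul, ← map_sub, mk_eq_zero_iff]
    refine Ideal.subset_span ⟨⟨1, ?_⟩, ?_⟩
    · refine (isHomogeneous_X k j).sub ?_
      exact (homogeneousSubmodule σ k 1).smul_mem _ (isHomogeneous_X k i)
    · rw [map_sub, smul_eval, eval_X, eval_X, mul_assoc, inv_mul_cancel₀ hi, mul_one, sub_self]
  let θ : MvPolynomial τ k →ₐ[k] (point p).coordRing ⊗[k] T.coordRing :=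
    aeval fun j => (c ⊗ₜ[k] (1 : T.coordRing)) * ((1 : (point p).coordRing) ⊗ₜ[k] T.mk (X j))
  have h : (point p).segreHom T = θ.comp (pointFibre p) := by
    refine algHom_ext fun ij => ?_
    simp only [AlgHom.comp_apply, segreHom, pointFibre, aeval_X, θ, map_mul, hc]
    rw [← MvPolynomial.algebraMap_eq, AlgHom.commutes, Algebra.TensorProduct.tmul_mul_tmul, mul_one,
      one_mul, ← Algebra.smul_def, TensorProduct.smul_tmul']
  have hθ : ∀ G ∈ T.ideal, θ G = 0 := by
    intro G hG
    rw [← sum_homogeneousComponent G, map_sum]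
    refine Finset.sum_eq_zero fun d _ => ?_
    rw [MvPolynomial.IsHomogeneous.aeval_mul (homogeneousComponent_isHomogeneous d G)]
    have h1 : (aeval fun j => (1 : (point p).coordRing) ⊗ₜ[k] T.mk (X j) :
        MvPolynomial τ k →ₐ[k] (point p).coordRing ⊗[k] T.coordRing) =
        Algebra.TensorProduct.includeRight.comp T.mk :=
      algHom_ext fun j => by simp
    rw [h1, AlgHom.comp_apply, T.mk_eq_zero_iff.mpr (homogeneousComponent_mem_of_mem
      T.homogeneous hG d), map_zero, mul_zero]
  rw [h, AlgHom.comp_apply, hθ _ hF]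

theorem IsHyperplaneSection.exists_linear [Finite σ] {p : ℙ k (σ → k)} {W H : ProjSubscheme k τ}
    (hH : ((point p).segre H).IsHyperplaneSection ((point p).segre W)) :
    ∃ l : MvPolynomial τ k, l.IsHomogeneous 1 ∧ l ∉ W.ideal ∧ l ∈ H.ideal ∧
      H.ideal ≤ irrelevantSaturation (W.ideal ⊔ Ideal.span {l}) := by
  obtain ⟨L, hL1, hLW, hLH⟩ := hH
  obtain ⟨i, hi⟩ : ∃ i, p.rep i ≠ 0 := by
    by_contra! h
    exact p.rep_nonzero (funext h)
  refine ⟨pointFibre p L, ?_, fun h => hLW (mem_ker_of_pointFibre_mem p W h), ?_, fun G hG j => ?_⟩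
  · have := hL1.aeval (fun ij : σ × τ => C (p.rep ij.1) * X (R := k) ij.2) (n := 1) fun ij => by
      simpa using (isHomogeneous_C τ (p.rep ij.1)).mul (isHomogeneous_X k ij.2)
    rw [one_mul] at this
    exact this
  · refine pointFibre_mem_of_mem_ker p H ?_
    have h1 : L ∈ ((point p).segre H).ideal := by
      rw [hLH]
      exact fun _ => ⟨0, by
        rw [pow_zero, one_mul]
        exact Ideal.mem_sup_right (Ideal.mem_span_singleton_self L)⟩
    exact h1
  · let s : MvPolynomial τ k →ₐ[k] MvPolynomial (σ × τ) k := aeval fun j => C (p.rep i)⁻¹ * X (i, j)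
    have hs : (pointFibre p).comp s = AlgHom.id k (MvPolynomial τ k) := by
      refine algHom_ext fun j => ?_
      simp only [AlgHom.comp_apply, s, pointFibre, aeval_X, map_mul, AlgHom.id_apply, algHom_C,
        MvPolynomial.algebraMap_eq]
      rw [← mul_assoc, ← C_mul, inv_mul_cancel₀ hi, C_1, one_mul]
    have hsG : pointFibre p (s G) = G := DFunLike.congr_fun hs G
    have h1 : s G ∈ ((point p).segre H).ideal :=
      mem_ker_of_pointFibre_mem p H (by rwa [hsG])
    rw [hLH] at h1
    obtain ⟨n, hn⟩ := h1 (i, j)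
    have h2 : ((point p).segre W).ideal ⊔ Ideal.span {L} ≤
        (W.ideal ⊔ Ideal.span {pointFibre p L}).comap (pointFibre p) := by
      refine sup_le (fun F hF => ?_) ((Ideal.span_singleton_le_iff_mem _).mpr ?_)
      · exact Ideal.mem_sup_left (pointFibre_mem_of_mem_ker p W hF)
      · exact Ideal.mem_sup_right (Ideal.mem_span_singleton_self _)
    have h3 := h2 hn
    rw [Ideal.mem_comap, map_mul, map_pow, hsG, pointFibre, aeval_X, mul_pow, mul_assoc] at h3
    refine ⟨n, ?_⟩
    have h4 := Ideal.mul_mem_left _ (C (p.rep i)⁻¹ ^ n) h3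
    rwa [← mul_assoc, ← mul_pow, ← C_mul, inv_mul_cancel₀ hi, C_1, one_pow, one_mul] at h4

end Point

end ProjSubscheme

lemma MvPolynomial.homogeneousSubmodule_succ_le {k : Type*} [CommRing k] {ι : Type*} {d : ℕ}
    {N : Submodule k (MvPolynomial ι k)}
    (h : ∀ P ∈ homogeneousSubmodule ι k d, ∀ i, P * X i ∈ N) :
    homogeneousSubmodule ι k (d + 1) ≤ N := by
  rw [← homogeneousSubmodule_one_pow, pow_succ, homogeneousSubmodule_one_pow, Submodule.mul_le]
  intro P hP Q hQ
  rw [homogeneousSubmodule_one_eq_span_X] at hQ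
  have h2 : Submodule.span k (Set.range X) ≤ N.comap (LinearMap.mulLeft k P) := by
    rw [Submodule.span_le]
    rintro _ ⟨i, rfl⟩
    exact h P hP i
  exact h2 hQ

namespace ProjSubscheme

variable {k : Type u} [Field k] {σ τ : Type}

section Twist

variable {E : Type u} [CommRing E] [Algebra k E] (e : σ → E) (T : ProjSubscheme k τ)

/-- The map `z_{ij} ↦ e_i ⊗ y_j`. -/
def twistHom : MvPolynomial (σ × τ) k →ₐ[k] E ⊗[k] T.coordRing :=
  aeval fun ij => e ij.1 ⊗ₜ[k] T.mk (X ij.2)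

lemma twistHom_X (ij : σ × τ) : twistHom e T (X ij) = e ij.1 ⊗ₜ[k] T.mk (X ij.2) :=
  aeval_X _ _

lemma twistHom_mk_X (S : ProjSubscheme k σ) :
    twistHom (fun i => S.mk (X i)) T = S.segreHom T := rfl

lemma twistHom_monomial (s : σ × τ →₀ ℕ) (c : k) :
    ∃ a, ∃ b ∈ T.grading s.degree, twistHom e T (monomial s c) = a ⊗ₜ[k] b := by
  induction s using Finsupp.induction_linear generalizing c with
  | zero =>
    refine ⟨c • 1, 1, by simpa using SetLike.GradedOne.one_mem, ?_⟩
    rw [← C_apply, ← algebraMap_eq, AlgHom.commutes, Algebra.algebraMap_eq_smul_one,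
      Algebra.TensorProduct.one_def, TensorProduct.smul_tmul']
  | add s t hs ht =>
    obtain ⟨a, b, hb, hab⟩ := hs 1
    obtain ⟨a', b', hb', hab'⟩ := ht c
    refine ⟨a * a', b * b', ?_, ?_⟩
    · rw [map_add]
      exact SetLike.GradedMul.mul_mem hb hb'
    · rw [← one_mul c, ← monomial_mul, map_mul, hab, hab', Algebra.TensorProduct.tmul_mul_tmul]
  | single ij N =>
    refine ⟨c • e ij.1 ^ N, T.mk (X ij.2 ^ N), ?_, ?_⟩
    · apply T.mk_mem_grading
      simpa using (isHomogeneous_X k ij.2).pow N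
    · rw [twistHom, aeval_monomial, Finsupp.prod_single_index (by simp)]
      simp [Algebra.algebraMap_eq_smul_one, Algebra.TensorProduct.tmul_pow,
        TensorProduct.smul_tmul']

lemma twistHom_homogeneousComponent (d : ℕ) (F : MvPolynomial (σ × τ) k) :
    twistHom e T (homogeneousComponent d F) =
      (GradedAlgebra.proj T.grading d).lTensor E (twistHom e T F) := by
  induction F using MvPolynomial.induction_on' with
  | add F G hF hG => rw [map_add, map_add, map_add, map_add, hF, hG]
  | monomial s c =>
    obtain ⟨a, b, hb, hab⟩ := twistHom_monomial e T s c
    have hs : monomial s c ∈ homogeneousSubmodule (σ × τ) k s.degree :=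
      isHomogeneous_monomial c rfl
    rw [homogeneousComponent_of_mem hs, hab, LinearMap.lTensor_tmul, GradedAlgebra.proj_apply]
    split_ifs with h
    · rw [hab, h, DirectSum.decompose_of_mem_same _ hb]
    · rw [DirectSum.decompose_of_mem_ne _ hb (Ne.symm h), map_zero, TensorProduct.tmul_zero]

/-- The linear forms `l(z_{i0}, …, z_{im})`. -/
def rowForm (l : MvPolynomial τ k) (i : σ) : MvPolynomial (σ × τ) k :=
  rename (fun j => (i, j)) l

lemma twistHom_rowForm {l : MvPolynomial τ k} (hl : l.IsHomogeneous 1) (i : σ) :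
    twistHom e T (rowForm l i) = e i ⊗ₜ[k] T.mk l := by
  have h1 : (aeval fun j => (1 : E) ⊗ₜ[k] T.mk (X j) : MvPolynomial τ k →ₐ[k] E ⊗[k] T.coordRing) =
      Algebra.TensorProduct.includeRight.comp T.mk :=
    algHom_ext fun j => by simp
  have h2 : ((fun ij : σ × τ => e ij.1 ⊗ₜ[k] T.mk (X ij.2)) ∘ fun j => (i, j)) =
      fun j => (e i ⊗ₜ[k] (1 : T.coordRing)) * ((1 : E) ⊗ₜ[k] T.mk (X j)) := by
    ext j; simp
  rw [rowForm, twistHom, aeval_rename, h2, hl.aeval_mul, h1]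
  simp

lemma tmul_mem_range_twistHom {d : ℕ} {P : MvPolynomial σ k}
    (hP : P ∈ homogeneousSubmodule σ k d) {Q : MvPolynomial τ k}
    (hQ : Q ∈ homogeneousSubmodule τ k d) :
    aeval e P ⊗ₜ[k] T.mk Q ∈ LinearMap.range (twistHom e T).toLinearMap := by
  induction d generalizing P Q with
  | zero =>
    rw [mem_homogeneousSubmodule, ← totalDegree_zero_iff_isHomogeneous,
      totalDegree_eq_zero_iff_eq_C] at hP hQ
    rw [hP, hQ]
    refine ⟨C (coeff 0 P * coeff 0 Q), ?_⟩
    rw [← MvPolynomial.algebraMap_eq, ← MvPolynomial.algebraMap_eq, AlgHom.commutes,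
      ← MvPolynomial.algebraMap_eq, AlgHom.commutes, AlgHom.toLinearMap_apply, AlgHom.commutes,
      map_mul, Algebra.TensorProduct.algebraMap_apply, Algebra.TensorProduct.algebraMap_apply',
      Algebra.TensorProduct.tmul_mul_tmul, mul_one, one_mul]
  | succ d ih =>
    refine homogeneousSubmodule_succ_le (N := (LinearMap.range (twistHom e T).toLinearMap).comap
      ((TensorProduct.mk k E T.coordRing).flip (T.mk Q) ∘ₗ (aeval e).toLinearMap)) ?_ hP
    intro P₁ hP₁ i
    refine homogeneousSubmodule_succ_le (N := (LinearMap.range (twistHom e T).toLinearMap).comap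
      (TensorProduct.mk k E T.coordRing (aeval e (P₁ * X i)) ∘ₗ T.mk.toLinearMap)) ?_ hQ
    intro Q₁ hQ₁ j
    obtain ⟨F, hF⟩ := ih hP₁ hQ₁
    refine ⟨F * X (i, j), ?_⟩
    simp only [AlgHom.toLinearMap_apply, LinearMap.comp_apply, map_mul, twistHom_X, aeval_X,
      TensorProduct.mk_apply] at hF ⊢
    rw [hF, Algebra.TensorProduct.tmul_mul_tmul]

/-- Multiples of `e_{i_1} ⋯ e_{i_n} ⊗ l ^ n` come from the `n`-th power of the ideal of the
`l(z_{i0}, …, z_{im})`. -/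
lemma tmul_mem_map_span_rowForm_pow {l : MvPolynomial τ k} (hl : l.IsHomogeneous 1) {d n : ℕ}
    {P : MvPolynomial σ k} (hP : P ∈ homogeneousSubmodule σ k (d + n)) {Q : MvPolynomial τ k}
    (hQ : Q ∈ homogeneousSubmodule τ k d) :
    ∃ F ∈ Ideal.span (Set.range (rowForm (σ := σ) l)) ^ n,
      twistHom e T F = aeval e P ⊗ₜ[k] T.mk (Q * l ^ n) := by
  suffices h : aeval e P ⊗ₜ[k] T.mk (Q * l ^ n) ∈
      (((Ideal.span (Set.range (rowForm (σ := σ) l)) ^ n).restrictScalars k).map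
        (twistHom e T).toLinearMap) from h
  induction n generalizing P with
  | zero =>
    obtain ⟨F, hF⟩ := tmul_mem_range_twistHom e T hP hQ
    exact ⟨F, by simp, by simpa using hF⟩
  | succ n ih =>
    refine homogeneousSubmodule_succ_le (d := d + n) (N := Submodule.comap
      ((TensorProduct.mk k E T.coordRing).flip (T.mk (Q * l ^ (n + 1))) ∘ₗ (aeval e).toLinearMap)
      (((Ideal.span (Set.range (rowForm (σ := σ) l)) ^ (n + 1)).restrictScalars k).map
        (twistHom e T).toLinearMap)) ?_ hP
    intro P₁ hP₁ i
    obtain ⟨F, hF, hF'⟩ := ih hP₁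
    refine ⟨F * rowForm l i, ?_, ?_⟩
    · simp only [Submodule.coe_restrictScalars, SetLike.mem_coe] at hF ⊢
      rw [pow_succ]
      exact Ideal.mul_mem_mul hF (Ideal.subset_span ⟨i, rfl⟩)
    · simp only [AlgHom.toLinearMap_apply, LinearMap.comp_apply, map_mul, aeval_X,
        twistHom_rowForm e T hl] at hF' ⊢
      rw [hF', Algebra.TensorProduct.tmul_mul_tmul]
      simp [pow_succ, mul_assoc]

end Twist

/-- The ideal of `C(V × H)` in `C(V × W)` for a hyperplane section `H` of `W` by `l = 0`. -/
theorem coneIdeal_segre_eq [Finite σ] (V : ProjSubscheme k σ) {W H : ProjSubscheme k τ}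
    {l : MvPolynomial τ k} (hl : l.IsHomogeneous 1) (hH : H.ideal = W.ideal ⊔ Ideal.span {l}) :
    (V.segre H).coneIdeal (V.segre W) =
      (Ideal.span (Set.range (rowForm (σ := σ) l))).map (V.segre W).mk := by
  have hWH : W.ideal ≤ H.ideal := hH ▸ le_sup_left
  have hlH : H.mk l = 0 := H.mk_eq_zero_iff.mpr
    (hH ▸ Ideal.mem_sup_right (Ideal.mem_span_singleton_self l))
  apply le_antisymm
  · let q : W.coordRing →ₐ[k] H.coordRing := Ideal.Quotient.factorₐ k hWH
    have hq : ∀ F, q (W.mk F) = H.mk F := fun F => rfl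
    have hex : Function.Exact (LinearMap.mulLeft k (W.mk l)) q.toLinearMap := by
      intro b
      obtain ⟨F, rfl⟩ := W.mk_surjective b
      rw [AlgHom.toLinearMap_apply, hq, mk_eq_zero_iff, hH]
      constructor
      · intro h
        obtain ⟨G, hG, K, hK, rfl⟩ := Submodule.mem_sup.mp h
        obtain ⟨M, rfl⟩ := Ideal.mem_span_singleton'.mp hK
        refine ⟨W.mk M, ?_⟩
        rw [LinearMap.mulLeft_apply, map_add, W.mk_eq_zero_iff.mpr hG, zero_add, ← map_mul,
          mul_comm]
      · rintro ⟨b, hb⟩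
        obtain ⟨M, rfl⟩ := W.mk_surjective b
        rw [LinearMap.mulLeft_apply, ← map_mul, ← sub_eq_zero, ← map_sub, mk_eq_zero_iff] at hb
        rw [← neg_mem_iff, ← sub_add_cancel (-F) (-(l * M))]
        refine add_mem (Ideal.mem_sup_left (by simpa [sub_eq_add_neg, add_comm] using hb)) ?_
        exact neg_mem (Ideal.mem_sup_right (Ideal.mul_mem_right _ _
          (Ideal.mem_span_singleton_self l)))
    have hcomp : ∀ F, (q.toLinearMap.lTensor V.coordRing) (V.segreHom W F) = V.segreHom H F := by
      have : (Algebra.TensorProduct.map (AlgHom.id k V.coordRing) q).comp (V.segreHom W)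
          = V.segreHom H := by
        refine algHom_ext fun ij => ?_
        simp [segreHom, hq]
      exact fun F => DFunLike.congr_fun this F
    have key : ∀ d F, homogeneousComponent d F = F → V.segreHom H F = 0 →
        V.segreHom W F ∈ ((Ideal.span (Set.range (rowForm (σ := σ) l))).restrictScalars k).map
          (V.segreHom W).toLinearMap := by
      intro d F hF h0
      rw [← hcomp] at h0
      obtain ⟨g, hg⟩ := (Module.Flat.lTensor_exact V.coordRing hex _).mp h0
      rw [← hF, segreHom_homogeneousComponent, ← hF, ← twistHom_mk_X,
        twistHom_homogeneousComponent, twistHom_mk_X, ← hg]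
      clear hg
      induction g with
      | zero => simp
      | add x y hx hy => simp only [map_add]; exact add_mem hx hy
      | tmul a b =>
        obtain ⟨P, rfl⟩ := V.mk_surjective a
        obtain ⟨Q, rfl⟩ := W.mk_surjective b
        rw [LinearMap.lTensor_tmul, LinearMap.lTensor_tmul, LinearMap.rTensor_tmul,
          LinearMap.mulLeft_apply, ← map_mul, mk_homogeneousComponent, mk_homogeneousComponent]
        rcases d with _ | d
        · have : homogeneousComponent 0 (l * Q) = 0 := by
            rw [homogeneousComponent_zero, ← constantCoeff_eq, map_mul, constantCoeff_eq,
              hl.coeff_eq_zero (by simp), zero_mul, C_0]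
          rw [this, map_zero, TensorProduct.tmul_zero]
          exact zero_mem _
        · have : homogeneousComponent (d + 1) (l * Q) = homogeneousComponent d Q * l ^ 1 := by
            have h3 := DirectSum.coe_decompose_mul_add_of_left_mem (homogeneousSubmodule τ k)
              (j := d) (b := Q) hl
            rw [pow_one, mul_comm _ l, add_comm d, ← decomposition.decompose'_apply,
              ← decomposition.decompose'_apply]
            exact h3
          rw [this]
          obtain ⟨G, hG, hG'⟩ := tmul_mem_map_span_rowForm_pow (fun i => V.mk (X i)) W hl (n := 1)
            (homogeneousComponent_isHomogeneous (d + 1) P)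
            (homogeneousComponent_isHomogeneous d Q)
          rw [pow_one] at hG
          refine ⟨G, hG, ?_⟩
          rw [AlgHom.toLinearMap_apply, ← twistHom_mk_X, hG']
          congr 1
          have : (aeval fun i => V.mk (X i)) = V.mk := algHom_ext fun i => by simp
          rw [this]
    refine Ideal.map_le_iff_le_comap.mpr fun F hF => ?_
    rw [← sum_homogeneousComponent F]
    refine Ideal.sum_mem _ fun d _ => ?_
    have hFd := homogeneousComponent_mem_of_mem (V.segre H).homogeneous hF d
    obtain ⟨G, hG, hG'⟩ := key d (homogeneousComponent d F)
      (by rw [homogeneousComponent_of_mem (homogeneousComponent_isHomogeneous d F), if_pos rfl]) hFd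
    have h1 : homogeneousComponent d F - G ∈ (V.segre W).ideal := by
      refine (RingHom.mem_ker).mpr ?_
      rw [map_sub, ← hG']
      exact sub_self _
    rw [← mk_eq_zero_iff, map_sub, sub_eq_zero] at h1
    rw [Ideal.mem_comap, h1]
    exact Ideal.mem_map_of_mem _ hG
  · refine Ideal.map_mono (Ideal.span_le.mpr ?_)
    rintro _ ⟨i, rfl⟩
    have := twistHom_rowForm (fun i => V.mk (X i)) H hl i
    rw [hlH, TensorProduct.tmul_zero, twistHom_mk_X] at this
    exact this

end ProjSubscheme

namespace ReesChart

/-- Injective ring homomorphisms with the same range have isomorphic domains. -/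
def equivOfRangeEq {A B L : Type*} [CommRing A] [CommRing B] [CommRing L] (f : A →+* L)
    (g : B →+* L) (hf : Function.Injective f) (hg : Function.Injective g)
    (h : Set.range f = Set.range g) : A ≃+* B :=
  ((RingEquiv.ofBijective f.rangeRestrict
    ⟨fun _ _ h => hf (congrArg Subtype.val h), f.rangeRestrict_surjective⟩).trans
    (RingEquiv.subringCongr (SetLike.coe_injective (by simpa using h)))).trans
    (RingEquiv.ofBijective g.rangeRestrict
      ⟨fun _ _ h => hg (congrArg Subtype.val h), g.rangeRestrict_surjective⟩).symm

variable {R T : Type u} [CommRing R] [CommRing T] {I : Ideal R}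

lemma coe_eq_monomial {n : ℕ} {x : reesAlgebra I} (hx : x ∈ reesGrading I n) :
    (x : Polynomial R) = Polynomial.monomial n ((x : Polynomial R).coeff n) := by
  ext i
  by_cases hi : i = n
  · subst hi; simp
  · rw [hx i hi, Polynomial.coeff_monomial_of_ne _ hi]

/-- The element `a t ^ n` of the Rees algebra. -/
def reesMonomial (I : Ideal R) (n : ℕ) (a : R) (ha : a ∈ I ^ n) : reesAlgebra I :=
  ⟨Polynomial.monomial n a, reesAlgebra.monomial_mem.mpr ha⟩

lemma reesMonomial_mem (n : ℕ) (a : R) (ha : a ∈ I ^ n) :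
    reesMonomial I n a ha ∈ reesGrading I n :=
  fun _ hi => Polynomial.coeff_monomial_of_ne _ hi

variable (φ : R →+* T) (a : R) (L : Type u) [CommRing L] [Algebra T L] [IsLocalization.Away (φ a) L]

/-- The map `c t ^ n ↦ φ c / φ a ^ n` from the Rees algebra. -/
def reesToAway (I : Ideal R) : reesAlgebra I →+* L :=
  (Polynomial.eval₂RingHom ((algebraMap T (L)).comp φ)
    (IsLocalization.Away.invSelf (S := L) (φ a))).comp (reesAlgebra I).subtype

lemma reesToAway_of_mem {n : ℕ} {x : reesAlgebra I} (hx : x ∈ reesGrading I n) :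
    reesToAway φ a L I x = algebraMap T L (φ ((x : Polynomial R).coeff n)) *
      IsLocalization.Away.invSelf (S := L) (φ a) ^ n := by
  change Polynomial.eval₂ _ _ (x : Polynomial R) = _
  rw [coe_eq_monomial hx, Polynomial.eval₂_monomial]
  simp

variable {a} (ha : a ∈ I ^ 1)

lemma reesToAway_reesMonomial_self : reesToAway φ a L I (reesMonomial I 1 a ha) = 1 := by
  rw [reesToAway_of_mem φ a L (reesMonomial_mem 1 a ha)]
  simp [reesMonomial, IsLocalization.Away.mul_invSelf]

/-- The map `c t ^ n / (a t) ^ n ↦ φ c / φ a ^ n` from the coordinate ring of a chart of the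
blow up. -/
def chartToAway : HomogeneousLocalization.Away (reesGrading I) (reesMonomial I 1 a ha) →+*
    L :=
  (IsLocalization.Away.lift (S := Localization.Away (reesMonomial I 1 a ha))
    (reesMonomial I 1 a ha) (g := reesToAway φ a L I)
    (by rw [reesToAway_reesMonomial_self φ L ha]; exact isUnit_one)).comp (algebraMap _ _)

lemma chartToAway_mk (n : ℕ) (x : reesAlgebra I) (hx : x ∈ reesGrading I (n • 1)) :
    chartToAway φ L ha (HomogeneousLocalization.Away.mk (reesGrading I) (reesMonomial_mem 1 a ha)
      n x hx) = algebraMap T L (φ ((x : Polynomial R).coeff n)) *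
      IsLocalization.Away.invSelf (S := L) (φ a) ^ n := by
  have hx' : x ∈ reesGrading I n := by simpa using hx
  rw [chartToAway, RingHom.comp_apply, HomogeneousLocalization.algebraMap_apply,
    HomogeneousLocalization.Away.val_mk, ← reesToAway_of_mem φ a L hx', Localization.mk_eq_mk',
    IsLocalization.Away.lift, IsLocalization.lift_mk'_spec]
  simp [reesToAway_reesMonomial_self φ L ha]

lemma chartToAway_injective (hφ : Function.Injective φ) (hreg : φ a ∈ nonZeroDivisors T) :
    Function.Injective (chartToAway φ L ha) := by
  rw [injective_iff_map_eq_zero]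
  intro z hz
  obtain ⟨n, x, hx, rfl⟩ := HomogeneousLocalization.Away.mk_surjective _ (reesMonomial_mem 1 a ha) z
  rw [chartToAway_mk φ L ha] at hz
  have hu : IsUnit (IsLocalization.Away.invSelf (S := L) (φ a)) :=
    IsUnit.of_mul_eq_one_right _ (IsLocalization.Away.mul_invSelf (S := L) (φ a))
  have h1 := ((hu.pow n).mul_left_eq_zero).mp hz
  have h2 := IsLocalization.injective (L)
    (Submonoid.powers_le.mpr hreg) (h1.trans (map_zero _).symm)
  have h3 := hφ (h2.trans (map_zero φ).symm)
  have hx' : x ∈ reesGrading I n := by simpa using hx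
  have h4 : x = 0 := by
    refine Subtype.ext ?_
    rw [coe_eq_monomial hx', h3]
    simp
  subst h4
  exact HomogeneousLocalization.mk_eq_zero_of_num _ rfl

lemma range_chartToAway (hI : I.map φ ≤ Ideal.span {φ a})
    (hsurj : ∀ u : T, ∃ n, ∃ c ∈ I ^ n, φ c = u * φ a ^ n) :
    Set.range (chartToAway φ L ha) = Set.range (algebraMap T L) := by
  have hinv : ∀ (u : T) (n : ℕ), algebraMap T (L) (u * φ a ^ n) *
      IsLocalization.Away.invSelf (S := L) (φ a) ^ n = algebraMap T L u := by
    intro u n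
    rw [map_mul, map_pow, mul_assoc, ← mul_pow, IsLocalization.Away.mul_invSelf, one_pow, mul_one]
  apply le_antisymm
  · rintro _ ⟨z, rfl⟩
    obtain ⟨n, x, hx, rfl⟩ :=
      HomogeneousLocalization.Away.mk_surjective _ (reesMonomial_mem 1 a ha) z
    have h1 : φ ((x : Polynomial R).coeff n) ∈ Ideal.span {φ a ^ n} := by
      rw [← Ideal.span_singleton_pow]
      refine Ideal.pow_right_mono hI n ?_
      rw [← Ideal.map_pow]
      exact Ideal.mem_map_of_mem _ (x.2 n)
    obtain ⟨u, hu⟩ := Ideal.mem_span_singleton'.mp h1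
    exact ⟨u, by rw [chartToAway_mk φ L ha, ← hu, hinv]⟩
  · rintro _ ⟨u, rfl⟩
    obtain ⟨n, c, hc, h⟩ := hsurj u
    refine ⟨HomogeneousLocalization.Away.mk (reesGrading I) (reesMonomial_mem 1 a ha) n
      (reesMonomial I n c hc) (by simpa using reesMonomial_mem n c hc), ?_⟩
    rw [chartToAway_mk φ L ha]
    simp only [reesMonomial, Polynomial.coeff_monomial, if_true]
    rw [h, hinv]

/-- The coordinate ring of the chart `D_+(a t)` of the blow up along `I` is `T`, if `T` is an
extension of `R` in which `I` becomes generated by the nonzerodivisor `a`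
and that is obtained by adjoining elements `c / a ^ n` with `c ∈ I ^ n`. -/
def chartEquiv (hφ : Function.Injective φ) (hreg : φ a ∈ nonZeroDivisors T)
    (hI : I.map φ ≤ Ideal.span {φ a})
    (hsurj : ∀ u : T, ∃ n, ∃ c ∈ I ^ n, φ c = u * φ a ^ n) :
    HomogeneousLocalization.Away (reesGrading I) (reesMonomial I 1 a ha) ≃+* T :=
  let L := Localization.Away (φ a)
  equivOfRangeEq (chartToAway φ L ha) (algebraMap T L) (chartToAway_injective φ L ha hφ hreg)
    (IsLocalization.injective L (Submonoid.powers_le.mpr hreg))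
    (range_chartToAway φ L ha hI hsurj)

end ReesChart

namespace ProjSubscheme

variable {k : Type u} [Field k] {σ τ : Type}

/-- A dehomogenization of the homogeneous coordinate ring of `V`: the functions `e_s = x_s / x_i` in
the ring `E`, which they generate, and the localization `L` at `x_i` containing both rings. -/
structure Dehomogenization (V : ProjSubscheme k σ) (i : σ) (E L : Type u) [CommRing E] [CommRing L]
    [Algebra k E] [Algebra k L] where
  /-- the functions `x_s / x_i` -/
  coord : σ → E
  /-- the inclusion of the dehomogenization -/
  incl : E →ₐ[k] L
  /-- the inclusion of the homogeneous coordinate ring -/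
  homIncl : V.coordRing →ₐ[k] L
  incl_injective : Function.Injective incl
  homIncl_injective : Function.Injective homIncl
  isUnit : IsUnit (homIncl (V.mk (X i)))
  mul_incl_coord : ∀ s, homIncl (V.mk (X i)) * incl (coord s) = homIncl (V.mk (X s))
  coord_self : coord i = 1
  exists_aeval_eq : ∀ u : E, ∃ n, ∃ P ∈ homogeneousSubmodule σ k n, aeval coord P = u

namespace Dehomogenization

variable {V : ProjSubscheme k σ} {i : σ} {E L : Type u} [CommRing E] [CommRing L]
    [Algebra k E] [Algebra k L] (D : V.Dehomogenization i E L) (W : ProjSubscheme k τ)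

lemma map_segreHom {d : ℕ} {F : MvPolynomial (σ × τ) k} (hF : F.IsHomogeneous d) :
    Algebra.TensorProduct.map D.homIncl (AlgHom.id k W.coordRing) (V.segreHom W F) =
      (D.homIncl (V.mk (X i)) ⊗ₜ[k] (1 : W.coordRing)) ^ d *
        Algebra.TensorProduct.map D.incl (AlgHom.id k W.coordRing) (twistHom D.coord W F) := by
  have h1 : (Algebra.TensorProduct.map D.homIncl (AlgHom.id k W.coordRing)).comp (V.segreHom W) =
      aeval fun ij => (D.homIncl (V.mk (X i)) ⊗ₜ[k] (1 : W.coordRing)) *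
        (D.incl (D.coord ij.1) ⊗ₜ[k] W.mk (X ij.2)) := by
    refine algHom_ext fun ij => ?_
    simp [segreHom, D.mul_incl_coord]
  have h2 : (Algebra.TensorProduct.map D.incl (AlgHom.id k W.coordRing)).comp
      (twistHom D.coord W) = aeval fun ij => D.incl (D.coord ij.1) ⊗ₜ[k] W.mk (X ij.2) := by
    refine algHom_ext fun ij => ?_
    simp [twistHom_X]
  have h3 := DFunLike.congr_fun h1 F
  have h4 := DFunLike.congr_fun h2 F
  rw [AlgHom.comp_apply] at h3 h4
  rw [h3, hF.aeval_mul, h4]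

lemma map_id_injective {A B C : Type u} [CommRing A] [CommRing B] [CommRing C] [Algebra k A]
    [Algebra k B] [Algebra k C] {f : A →ₐ[k] B} (hf : Function.Injective f) :
    Function.Injective (Algebra.TensorProduct.map f (AlgHom.id k C)) :=
  Module.Flat.rTensor_preserves_injective_linearMap (M := C) f.toLinearMap hf

lemma segreHom_eq_zero_iff_of_isHomogeneous {d : ℕ} {F : MvPolynomial (σ × τ) k}
    (hF : F.IsHomogeneous d) : V.segreHom W F = 0 ↔ twistHom D.coord W F = 0 := by
  have hu : IsUnit ((D.homIncl (V.mk (X i)) ⊗ₜ[k] (1 : W.coordRing)) ^ d) :=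
    (D.isUnit.map (Algebra.TensorProduct.includeLeft : L →ₐ[k] L ⊗[k] W.coordRing)).pow d
  rw [← map_eq_zero_iff _ (map_id_injective (C := W.coordRing) D.homIncl_injective),
    D.map_segreHom W hF, hu.mul_right_eq_zero,
    map_eq_zero_iff _ (map_id_injective (C := W.coordRing) D.incl_injective)]

lemma segreHom_eq_zero_iff (F : MvPolynomial (σ × τ) k) :
    V.segreHom W F = 0 ↔ twistHom D.coord W F = 0 := by
  constructor
  · intro h
    rw [← sum_homogeneousComponent F, map_sum]
    refine Finset.sum_eq_zero fun d _ => ?_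
    rw [← D.segreHom_eq_zero_iff_of_isHomogeneous W (homogeneousComponent_isHomogeneous d F),
      segreHom_homogeneousComponent, h, map_zero]
  · intro h
    rw [← sum_homogeneousComponent F, map_sum]
    refine Finset.sum_eq_zero fun d _ => ?_
    rw [D.segreHom_eq_zero_iff_of_isHomogeneous W (homogeneousComponent_isHomogeneous d F),
      twistHom_homogeneousComponent, h, map_zero]

variable [Finite σ]

/-- The map from the coordinate ring of the cone over `V × W` to functions on a chart of the
blow up. -/
def coneHom : (V.segre W).coordRing →+* E ⊗[k] W.coordRing :=
  Ideal.Quotient.lift (V.segre W).ideal (twistHom D.coord W : _ →+* E ⊗[k] W.coordRing)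
    fun F hF => (D.segreHom_eq_zero_iff W F).mp hF

lemma coneHom_mk (F : MvPolynomial (σ × τ) k) :
    D.coneHom W ((V.segre W).mk F) = twistHom D.coord W F := rfl

lemma coneHom_injective : Function.Injective (D.coneHom W) := by
  rw [injective_iff_map_eq_zero]
  intro x hx
  obtain ⟨F, rfl⟩ := (V.segre W).mk_surjective x
  exact (V.segre W).mk_eq_zero_iff.mpr ((D.segreHom_eq_zero_iff W F).mpr hx)

variable {W} {l : MvPolynomial τ k}

lemma coneHom_rowForm (hl : l.IsHomogeneous 1) (s : σ) :
    D.coneHom W ((V.segre W).mk (rowForm l s)) = D.coord s ⊗ₜ[k] W.mk l := by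
  rw [coneHom_mk, twistHom_rowForm _ _ hl]

lemma coneHom_rowForm_self (hl : l.IsHomogeneous 1) :
    D.coneHom W ((V.segre W).mk (rowForm l i)) = (1 : E) ⊗ₜ[k] W.mk l := by
  rw [D.coneHom_rowForm hl, D.coord_self]

lemma coneHom_rowForm_mem_nonZeroDivisors (hl : l.IsHomogeneous 1)
    (hW : W.IsVariety) (hlW : l ∉ W.ideal) :
    D.coneHom W ((V.segre W).mk (rowForm l i)) ∈ nonZeroDivisors (E ⊗[k] W.coordRing) := by
  rw [D.coneHom_rowForm_self hl]
  have : IsDomain W.coordRing := (Ideal.Quotient.isDomain_iff_prime W.ideal).mpr hW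
  have hl0 : W.mk l ≠ 0 := fun h => hlW (W.mk_eq_zero_iff.mp h)
  have hinj : Function.Injective (LinearMap.mulLeft k (W.mk l)) :=
    fun x y h => mul_left_cancel₀ hl0 h
  have h2 := Module.Flat.lTensor_preserves_injective_linearMap (M := E) _ hinj
  have h3 : ∀ x : E ⊗[k] W.coordRing,
      (LinearMap.mulLeft k (W.mk l)).lTensor E x = x * ((1 : E) ⊗ₜ[k] W.mk l) := by
    intro x
    induction x with
    | zero => simp
    | add x y hx hy => rw [map_add, hx, hy, add_mul]
    | tmul a b => simp [mul_comm]
  rw [mem_nonZeroDivisors_iff_right]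
  intro x hx
  rw [← h3] at hx
  exact h2 (hx.trans (map_zero _).symm)

lemma map_coneHom_le (hl : l.IsHomogeneous 1) :
    ((Ideal.span (Set.range (rowForm (σ := σ) l))).map (V.segre W).mk).map (D.coneHom W) ≤
      Ideal.span {D.coneHom W ((V.segre W).mk (rowForm l i))} := by
  rw [Ideal.map_le_iff_le_comap, Ideal.map_le_iff_le_comap, Ideal.span_le]
  rintro _ ⟨s, rfl⟩
  rw [D.coneHom_rowForm_self hl, SetLike.mem_coe, Ideal.mem_comap, Ideal.mem_comap,
    D.coneHom_rowForm hl, Ideal.mem_span_singleton']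
  exact ⟨D.coord s ⊗ₜ[k] 1, by simp⟩

lemma exists_coneHom_eq (hl : l.IsHomogeneous 1) (u : E ⊗[k] W.coordRing) :
    ∃ n, ∃ c ∈ ((Ideal.span (Set.range (rowForm (σ := σ) l))).map (V.segre W).mk) ^ n,
      D.coneHom W c = u * D.coneHom W ((V.segre W).mk (rowForm l i)) ^ n := by
  have hadd : ∀ u v : E ⊗[k] W.coordRing,
      (∃ n, ∃ c ∈ ((Ideal.span (Set.range (rowForm (σ := σ) l))).map (V.segre W).mk) ^ n,
        D.coneHom W c = u * D.coneHom W ((V.segre W).mk (rowForm l i)) ^ n) →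
      (∃ n, ∃ c ∈ ((Ideal.span (Set.range (rowForm (σ := σ) l))).map (V.segre W).mk) ^ n,
        D.coneHom W c = v * D.coneHom W ((V.segre W).mk (rowForm l i)) ^ n) →
      ∃ n, ∃ c ∈ ((Ideal.span (Set.range (rowForm (σ := σ) l))).map (V.segre W).mk) ^ n,
        D.coneHom W c = (u + v) * D.coneHom W ((V.segre W).mk (rowForm l i)) ^ n := by
    rintro u v ⟨n, c, hc, h⟩ ⟨n', c', hc', h'⟩
    have ha : (V.segre W).mk (rowForm l i) ∈
        (Ideal.span (Set.range (rowForm (σ := σ) l))).map (V.segre W).mk :=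
      Ideal.mem_map_of_mem _ (Ideal.subset_span ⟨i, rfl⟩)
    refine ⟨n + n', c * (V.segre W).mk (rowForm l i) ^ n' + (V.segre W).mk (rowForm l i) ^ n * c',
      add_mem ?_ ?_, ?_⟩
    · rw [pow_add]; exact Ideal.mul_mem_mul hc (Ideal.pow_mem_pow ha _)
    · rw [pow_add]; exact Ideal.mul_mem_mul (Ideal.pow_mem_pow ha _) hc'
    · rw [map_add, map_mul, map_mul, map_pow, map_pow, h, h']
      ring
  have hzero : ∃ n, ∃ c ∈ ((Ideal.span (Set.range (rowForm (σ := σ) l))).map (V.segre W).mk) ^ n,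
      D.coneHom W c = 0 * D.coneHom W ((V.segre W).mk (rowForm l i)) ^ n :=
    ⟨0, 0, zero_mem _, by simp⟩
  induction u with
  | zero => exact hzero
  | add u v hu hv => exact hadd u v hu hv
  | tmul a b =>
    obtain ⟨Q, rfl⟩ := W.mk_surjective b
    rw [← sum_homogeneousComponent Q, map_sum, TensorProduct.tmul_sum]
    refine Finset.sum_induction _ (fun u => ∃ n, ∃ c ∈
      ((Ideal.span (Set.range (rowForm (σ := σ) l))).map (V.segre W).mk) ^ n,
        D.coneHom W c = u * D.coneHom W ((V.segre W).mk (rowForm l i)) ^ n) hadd hzero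
      fun f _ => ?_
    obtain ⟨n, P, hP, rfl⟩ := D.exists_aeval_eq a
    have hP' : P * X i ^ f ∈ homogeneousSubmodule σ k (f + n) := by
      rw [add_comm]
      exact IsHomogeneous.mul hP (isHomogeneous_X_pow i f)
    obtain ⟨F, hF, hF'⟩ := tmul_mem_map_span_rowForm_pow D.coord W hl hP'
      (homogeneousComponent_isHomogeneous f Q)
    refine ⟨n, (V.segre W).mk F, ?_, ?_⟩
    · rw [← Ideal.map_pow]
      exact Ideal.mem_map_of_mem _ hF
    · rw [coneHom_mk, hF', D.coneHom_rowForm_self hl, Algebra.TensorProduct.tmul_pow,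
        Algebra.TensorProduct.tmul_mul_tmul]
      simp [D.coord_self]

/-- The charts of the blow up of `C(V × W)` along `C(V × {l = 0})`. -/
theorem nonempty_chart_ringEquiv (D : V.Dehomogenization i E L) (hl : l.IsHomogeneous 1)
    (hW : W.IsVariety) (hlW : l ∉ W.ideal)
    {J : Ideal (V.segre W).coordRing}
    (hJ : J = (Ideal.span (Set.range (rowForm (σ := σ) l))).map (V.segre W).mk)
    (ha : (V.segre W).mk (rowForm l i) ∈ J ^ 1) :
    Nonempty (HomogeneousLocalization.Away (reesGrading J)
      (ReesChart.reesMonomial J 1 ((V.segre W).mk (rowForm l i)) ha) ≃+* E ⊗[k] W.coordRing) := by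
  subst hJ
  exact ⟨ReesChart.chartEquiv (D.coneHom W) ha (D.coneHom_injective W)
    (D.coneHom_rowForm_mem_nonZeroDivisors hl hW hlW) (D.map_coneHom_le hl)
    (D.exists_coneHom_eq hl)⟩

end Dehomogenization

end ProjSubscheme

namespace ProjSubscheme

variable {k : Type u} [Field k] {σ : Type} (V : ProjSubscheme k σ) (i : σ)

lemma mk_X_mem_grading (s : σ) : V.mk (X s) ∈ V.grading 1 :=
  V.mk_mem_grading (isHomogeneous_X k s)

/-- The coordinate ring of the affine chart `x_i ≠ 0` of `V`. -/
def AffineChart : Type u := HomogeneousLocalization.Away V.grading (V.mk (X i))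

instance : CommRing (V.AffineChart i) :=
  inferInstanceAs (CommRing (HomogeneousLocalization.Away V.grading (V.mk (X i))))

instance : Algebra k (V.AffineChart i) :=
  ((HomogeneousLocalization.fromZeroRingHom V.grading (Submonoid.powers (V.mk (X i)))).comp
    (algebraMap k (V.grading 0))).toAlgebra

lemma smooth_affineChart (hV : V.IsSmooth) : Algebra.Smooth k (V.AffineChart i) := by
  have h0 : Smooth (Proj.toSpecZero V.grading ≫
      Spec.map (CommRingCat.ofHom (algebraMap k (V.grading 0)))) := hV
  have h1 : Smooth (Proj.awayι V.grading (V.mk (X i)) (V.mk_X_mem_grading i) one_pos ≫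
      Proj.toSpecZero V.grading ≫ Spec.map (CommRingCat.ofHom (algebraMap k (V.grading 0)))) :=
    MorphismProperty.comp_mem _ _ _ inferInstance h0
  rw [Proj.awayι_toSpecZero_assoc, ← Spec.map_comp, ← CommRingCat.ofHom_comp,
    HasRingHomProperty.Spec_iff (P := @Smooth)] at h1
  exact h1

/-- The inclusion of the coordinate ring of the chart `x_i ≠ 0` in the localization at `x_i`. -/
def affineChartIncl : V.AffineChart i →ₐ[k] Localization.Away (V.mk (X i)) where
  toRingHom := algebraMap (HomogeneousLocalization.Away V.grading (V.mk (X i))) _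
  commutes' _ := rfl

/-- The function `a / x_i ^ n`. -/
def affineChartMk {n : ℕ} {P : MvPolynomial σ k} (hP : P ∈ homogeneousSubmodule σ k n) :
    V.AffineChart i :=
  HomogeneousLocalization.Away.mk V.grading (V.mk_X_mem_grading i) n (V.mk P)
    (by simpa using V.mk_mem_grading hP)

lemma pow_mul_affineChartIncl_mk {n : ℕ} {P : MvPolynomial σ k}
    (hP : P ∈ homogeneousSubmodule σ k n) :
    algebraMap V.coordRing (Localization.Away (V.mk (X i))) (V.mk (X i)) ^ n *
      V.affineChartIncl i (V.affineChartMk i hP) = algebraMap V.coordRing _ (V.mk P) := by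
  have h : V.affineChartIncl i (V.affineChartMk i hP) =
      Localization.mk (V.mk P) ⟨V.mk (X i) ^ n, Submonoid.pow_mem _ (Submonoid.mem_powers _) n⟩ :=
    HomogeneousLocalization.Away.val_mk V.grading n (V.mk_X_mem_grading i) _ _
  rw [h, Localization.mk_eq_mk', ← map_pow]
  exact IsLocalization.mk'_spec' (Localization.Away (V.mk (X i))) (V.mk P)
    (⟨V.mk (X i) ^ n, Submonoid.pow_mem _ (Submonoid.mem_powers _) n⟩ :
      Submonoid.powers (V.mk (X i)))

lemma affineChartIncl_injective : Function.Injective (V.affineChartIncl i) :=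
  HomogeneousLocalization.val_injective _

/-- The standard dehomogenization with respect to `x_i`. -/
def dehomogenization (hV : V.IsVariety) (hi : V.mk (X i) ≠ 0) :
    V.Dehomogenization i (V.AffineChart i) (Localization.Away (V.mk (X i))) := by
  have hdom : IsDomain V.coordRing := (Ideal.Quotient.isDomain_iff_prime V.ideal).mpr hV
  have hunit : IsUnit (algebraMap V.coordRing (Localization.Away (V.mk (X i))) (V.mk (X i))) :=
    IsLocalization.Away.algebraMap_isUnit _
  have hmul : ∀ s, algebraMap V.coordRing (Localization.Away (V.mk (X i))) (V.mk (X i)) *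
      V.affineChartIncl i (V.affineChartMk i (isHomogeneous_X k s)) =
        algebraMap V.coordRing _ (V.mk (X s)) := fun s => by
    simpa using V.pow_mul_affineChartIncl_mk i (isHomogeneous_X k s)
  exact
  { coord := fun s => V.affineChartMk i (isHomogeneous_X k s)
    incl := V.affineChartIncl i
    homIncl := IsScalarTower.toAlgHom k V.coordRing _
    incl_injective := V.affineChartIncl_injective i
    homIncl_injective := IsLocalization.injective _ (powers_le_nonZeroDivisors_of_noZeroDivisors hi)
    isUnit := hunit
    mul_incl_coord := hmul
    coord_self := V.affineChartIncl_injective i (hunit.mul_left_cancel (by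
      rw [hmul, map_one, mul_one]))
    exists_aeval_eq := by
      intro u
      obtain ⟨n, a, ha, rfl⟩ :=
        HomogeneousLocalization.Away.mk_surjective V.grading (V.mk_X_mem_grading i) u
      have ha' : a ∈ V.grading n := by simpa using ha
      obtain ⟨P, hP, rfl⟩ := ha'
      refine ⟨n, P, hP, V.affineChartIncl_injective i ((hunit.pow n).mul_left_cancel ?_)⟩
      refine Eq.trans ?_ (V.pow_mul_affineChartIncl_mk i hP).symm
      have h1 : (V.affineChartIncl i).comp (aeval fun s => V.affineChartMk i (isHomogeneous_X k s))
          = aeval fun s => V.affineChartIncl i (V.affineChartMk i (isHomogeneous_X k s)) :=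
        algHom_ext fun s => by simp
      have h2 : (IsScalarTower.toAlgHom k V.coordRing (Localization.Away (V.mk (X i)))).comp V.mk =
          aeval fun s => algebraMap V.coordRing (Localization.Away (V.mk (X i))) (V.mk (X i)) *
            V.affineChartIncl i (V.affineChartMk i (isHomogeneous_X k s)) :=
        algHom_ext fun s => by simp [hmul]
      have h3 := DFunLike.congr_fun h1 P
      have h4 := DFunLike.congr_fun h2 P
      rw [AlgHom.comp_apply] at h3 h4
      rw [h3, ← IsHomogeneous.aeval_mul hP, ← h4]
      rfl }

end ProjSubscheme

section GorensteinCharts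

lemma isGorensteinLocalRing_stalk_Spec {R : CommRingCat.{u}}
    (hR : ∀ (q : Ideal R) [q.IsPrime], IsGorensteinLocalRing (Localization.AtPrime q))
    (y : Spec R) : IsGorensteinLocalRing ((Spec R).presheaf.stalk y) := by
  let : Algebra R ((Spec R).presheaf.stalk y) := StructureSheaf.stalkAlgebra R y
  have hy : y.asIdeal.IsPrime := y.2
  have : IsLocalization.AtPrime ((Spec R).presheaf.stalk y) y.asIdeal :=
    StructureSheaf.IsLocalization.to_stalk R y
  exact (hR y.asIdeal).of_ringEquiv
    (IsLocalization.algEquiv y.asIdeal.primeCompl (Localization.AtPrime y.asIdeal)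
      ((Spec R).presheaf.stalk y)).toRingEquiv

lemma isGorensteinScheme_Proj_of_charts {R A : Type u} [CommRing R] [CommRing A] [Algebra R A]
    (𝒜 : ℕ → Submodule R A) [GradedAlgebra 𝒜] {ι : Type} (f : ι → A) (hf : ∀ i, f i ∈ 𝒜 1)
    (hspan : (HomogeneousIdeal.irrelevant 𝒜).toIdeal ≤ Ideal.span (Set.range f))
    (hN : ∀ i, IsNoetherianRing (HomogeneousLocalization.Away 𝒜 (f i)))
    (hG : ∀ i (q : Ideal (HomogeneousLocalization.Away 𝒜 (f i))) [q.IsPrime],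
      IsGorensteinLocalRing (Localization.AtPrime q)) : IsGorensteinScheme (Proj 𝒜) := by
  let 𝒰 := Proj.affineOpenCoverOfIrrelevantLESpan 𝒜 f hf (fun _ => one_pos) hspan
  refine ⟨?_, fun x => ?_⟩
  · rw [isLocallyNoetherian_iff_openCover 𝒰.openCover]
    intro i
    have : IsNoetherianRing (CommRingCat.of (HomogeneousLocalization.Away 𝒜 (f i))) := hN i
    exact inferInstanceAs
      (IsLocallyNoetherian (Spec (CommRingCat.of (HomogeneousLocalization.Away 𝒜 (f i)))))
  · obtain ⟨i, y, rfl⟩ : ∃ i y, 𝒰.f i y = x := ⟨_, 𝒰.covers x⟩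
    refine (isGorensteinLocalRing_stalk_Spec (R := 𝒰.X i) (fun q hq => @hG i q hq) y).of_ringEquiv ?_
    exact (asIso ((𝒰.f i).stalkMap y)).symm.commRingCatIsoToRingEquiv

/-- The irrelevant ideal of the Rees algebra is generated by generators of the ideal. -/
lemma ReesChart.irrelevant_le_span {R : Type u} [CommRing R] {J : Ideal R} {ι : Type} {a : ι → R}
    (hJ : J = Ideal.span (Set.range a)) (ha : ∀ i, a i ∈ J ^ 1) :
    (HomogeneousIdeal.irrelevant (reesGrading J)).toIdeal ≤
      Ideal.span (Set.range fun i => reesMonomial J 1 (a i) (ha i)) := by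
  rw [HomogeneousIdeal.toIdeal_irrelevant_le]
  intro n hn x hx
  obtain ⟨m, rfl⟩ : ∃ m, n = m + 1 := ⟨n - 1, by omega⟩
  set K := Ideal.span (Set.range fun i => reesMonomial J 1 (a i) (ha i))
  have hx' : x ∈ reesGrading J (m + 1) := hx
  suffices h : ∀ c ∈ J ^ (m + 1), ∃ hc : c ∈ J ^ (m + 1), reesMonomial J (m + 1) c hc ∈ K by
    obtain ⟨hc, h'⟩ := h _ (x.2 (m + 1))
    have : x = reesMonomial J (m + 1) _ hc := Subtype.ext (coe_eq_monomial hx')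
    rw [this]
    exact h'
  have hadd : ∀ c d : R, (∃ hc : c ∈ J ^ (m + 1), reesMonomial J (m + 1) c hc ∈ K) →
      (∃ hc : d ∈ J ^ (m + 1), reesMonomial J (m + 1) d hc ∈ K) →
      ∃ hc : c + d ∈ J ^ (m + 1), reesMonomial J (m + 1) (c + d) hc ∈ K := by
    rintro c d ⟨hc, h⟩ ⟨hd, h'⟩
    refine ⟨add_mem hc hd, ?_⟩
    have : reesMonomial J (m + 1) (c + d) (add_mem hc hd) =
        reesMonomial J (m + 1) c hc + reesMonomial J (m + 1) d hd :=
      Subtype.ext (map_add _ _ _)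
    rw [this]
    exact add_mem h h'
  intro c hc
  rw [pow_succ] at hc
  refine Submodule.mul_induction_on hc (fun p hp q hq => ?_) hadd
  have hq' : q ∈ Submodule.span R (Set.range a) := by rw [hJ] at hq; exact hq
  induction hq' using Submodule.span_induction with
  | mem q h =>
    obtain ⟨i, rfl⟩ := h
    refine ⟨by rw [pow_succ]; exact Ideal.mul_mem_mul hp hq, ?_⟩
    have : reesMonomial J (m + 1) (p * a i) (by rw [pow_succ]; exact Ideal.mul_mem_mul hp hq) =
        reesMonomial J m p hp * reesMonomial J 1 (a i) (ha i) :=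
      Subtype.ext (Polynomial.monomial_mul_monomial _ _ _ _).symm
    rw [this]
    exact K.mul_mem_left _ (Ideal.subset_span ⟨i, rfl⟩)
  | zero =>
    rw [mul_zero]
    refine ⟨zero_mem _, ?_⟩
    have : reesMonomial J (m + 1) 0 (zero_mem _) = 0 := Subtype.ext (map_zero _)
    rw [this]
    exact zero_mem _
  | add q r hq1 hr1 h1 h2 =>
    rw [mul_add]
    exact hadd _ _ (h1 (by rw [hJ]; exact hq1)) (h2 (by rw [hJ]; exact hr1))
  | smul r q hq1 h1 =>
    obtain ⟨h2, h3⟩ := h1 (by rw [hJ]; exact hq1)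
    have h4 : p * r • q = r * (p * q) := by rw [smul_eq_mul]; ring
    rw [h4]
    refine ⟨Ideal.mul_mem_left _ r h2, ?_⟩
    have : reesMonomial J (m + 1) (r * (p * q)) (Ideal.mul_mem_left _ r h2) =
        r • reesMonomial J (m + 1) (p * q) h2 := by
      refine Subtype.ext ?_
      simp [reesMonomial, Polynomial.smul_monomial]
    rw [this]
    exact Submodule.smul_of_tower_mem K r h3

end GorensteinCharts

namespace ProjSubscheme

variable {k : Type u} [Field k]

instance {σ : Type} [Finite σ] (W : ProjSubscheme k σ) : IsNoetherianRing W.coordRing :=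
  inferInstanceAs (IsNoetherianRing (MvPolynomial σ k ⧸ W.ideal))

/-- The local rings of the product of an affine chart of a smooth variety with the cone over a
complete intersection are Gorenstein. -/
lemma isGorensteinLocalRing_affineChart_tensorProduct {σ : Type} {N : ℕ} (V : ProjSubscheme k σ)
    (i : σ) (hV : V.IsSmooth) {W : ProjSubscheme k (Fin N)} (hW : W.IsVariety)
    (hci : W.IsCompleteIntersection) {C : Type u} [CommRing C]
    (f : C ≃+* V.AffineChart i ⊗[k] W.coordRing) :
    IsNoetherianRing C ∧ ∀ (q : Ideal C) [q.IsPrime],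
      IsGorensteinLocalRing (Localization.AtPrime q) := by
  have h1 : Algebra.Smooth k (V.AffineChart i) := V.smooth_affineChart i hV
  have h2 : Algebra.Smooth W.coordRing (W.coordRing ⊗[k] V.AffineChart i) := inferInstance
  let g : W.coordRing ⊗[k] V.AffineChart i ≃+* C :=
    (f.trans (Algebra.TensorProduct.comm k _ _).toRingEquiv).symm
  have h4 : IsNoetherianRing (W.coordRing ⊗[k] V.AffineChart i) :=
    Algebra.FiniteType.isNoetherianRing W.coordRing _
  refine ⟨isNoetherianRing_of_ringEquiv _ g, fun q _ => ?_⟩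
  have h3 := isGorensteinLocalRing_atPrime_of_smooth
    (hci.hasFiniteSelfInjectiveDimension hW) (q.comap g)
  exact h3.of_ringEquiv (IsLocalization.ringEquivOfRingEquiv
    (M := (q.comap g).primeCompl) (T := q.primeCompl) _ _ g (by
      ext x
      constructor
      · rintro ⟨y, hy, rfl⟩
        exact hy
      · intro hx
        exact ⟨g.symm x, by simpa [Ideal.primeCompl] using hx, by simp⟩))

end ProjSubscheme

end

theorem blowup_of_cone_Gorenstein {k : Type u} [Field k] [IsAlgClosed k] {n m : ℕ}
    (V : ProjSubscheme k (Fin (n + 1))) (W H : ProjSubscheme k (Fin (m + 1)))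
    (p : Projectivization k (Fin (n + 1) → k))
    (hV : V.IsVariety) (hVsmooth : V.IsSmooth)
    (hW : W.IsVariety) (hWsmooth : W.IsSmooth)
    (hp : ProjSubscheme.point p ≤ V)
    (hHW : H ≤ W)
    (hH : ((ProjSubscheme.point p).segre H).IsHyperplaneSection
      ((ProjSubscheme.point p).segre W))
    (hVdim : 0 < V.dim) (hWdim : 0 < W.dim)
    (hWci : W.IsCompleteIntersection)
    (hPN : ∀ L : ProjSubscheme k (Fin (m + 1)), L.IsLinear → (V.segre L).IsProjectivelyNormal) :
    IsGorensteinScheme (affineBlowUp ((V.segre H).coneIdeal (V.segre W))) := by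
  obtain ⟨l, hl, hlW, hlH, hHsat⟩ := hH.exists_linear
  have hHl : H.ideal = W.ideal ⊔ Ideal.span {l} :=
    le_antisymm (hHsat.trans (hWci.sup_span_singleton_saturated hW hWdim hl hlW))
      (sup_le hHW ((Ideal.span_singleton_le_iff_mem _).mpr hlH))
  have hJ := V.coneIdeal_segre_eq hl hHl
  set J := (V.segre H).coneIdeal (V.segre W)
  have ha : ∀ i, (V.segre W).mk (ProjSubscheme.rowForm l i) ∈ J ^ 1 := fun i => by
    rw [pow_one, hJ]
    exact Ideal.mem_map_of_mem _ (Ideal.subset_span ⟨i, rfl⟩)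
  let a : {i // V.mk (X i) ≠ 0} → (V.segre W).coordRing :=
    fun i => (V.segre W).mk (ProjSubscheme.rowForm l i.1)
  have hJ' : J = Ideal.span (Set.range a) := by
    rw [hJ, Ideal.map_span]
    refine le_antisymm (Ideal.span_le.mpr ?_) (Ideal.span_mono ?_)
    · rintro _ ⟨_, ⟨i, rfl⟩, rfl⟩
      by_cases hi : V.mk (X i) = 0
      · have h0 : (V.segre W).mk (ProjSubscheme.rowForm l i) = 0 := by
          rw [ProjSubscheme.mk_eq_zero_iff]
          have h1 := ProjSubscheme.twistHom_rowForm (fun i => V.mk (X i)) W hl i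
          rw [hi, TensorProduct.zero_tmul] at h1
          exact h1
        exact h0 ▸ Ideal.zero_mem _
      · exact Ideal.subset_span ⟨⟨i, hi⟩, rfl⟩
    · rintro _ ⟨i, rfl⟩
      exact ⟨_, ⟨i.1, rfl⟩, rfl⟩
  have key := fun i : {i // V.mk (X i) ≠ 0} =>
    V.isGorensteinLocalRing_affineChart_tensorProduct i.1 hVsmooth hW hWci
      (C := HomogeneousLocalization.Away (reesGrading J)
        (ReesChart.reesMonomial J 1 (a i) (ha i.1)))
      ((V.dehomogenization i.1 hV i.2).nonempty_chart_ringEquiv hl hW hlW hJ (ha i.1)).some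
  exact isGorensteinScheme_Proj_of_charts (reesGrading J) _
    (fun i => ReesChart.reesMonomial_mem 1 (a i) (ha i.1))
    (ReesChart.irrelevant_le_span hJ' fun i => ha i.1) (fun i => (key i).1) fun i => (key i).2
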